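/- Let S be the spectrum of a Noetherian strictly henselian local ring with closed point s, let f: X → S be a semistable morphism, and let η be a generalisation of s. Then every irreducible component Y of the fibre X_η is geometrically irreducible. -/

import Mathlib

/-!
Common infrastructure for formalizing "Néron models of jacobians over base schemes of
dimension greater than 1" (semistable morphisms, strata, dual graphs, alignment,
specialisation maps, Cartier/Weil divisors, Picard data, Néron models).

Notes on design choices (Mathlib has no algebraic spaces, no Picard functor, no strict
henselisation and no excellent rings):
* Algebraic spaces are replaced by schemes throughout.
* The label of a point of a semistable morphism over a strictly henselian local base is
  taken in the local ring itself (which agrees with the strict henselisation there), and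
  alignment over a general base is defined via base change to arbitrary strictly
  henselian Noetherian local test rings (which is equivalent to the definition via
  geometric points, since the strict henselisations are among such test rings).
* Excellence of the base is beyond current Mathlib and is omitted from hypotheses.
-/

open AlgebraicGeometry CategoryTheory CategoryTheory.Limits

universe u

noncomputable section

namespace NeronSemistable

/-! ### Local properties of morphisms of schemes -/

/-- `f` is smooth at the point `x` if it is smooth on an open neighbourhood of `x`. -/
def SmoothAtPt {X S : Scheme.{u}} (f : X ⟶ S) (x : X) : Prop :=
  ∃ U : X.Opens, x ∈ U ∧ IsSmooth (U.ι ≫ f)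

/-- `f` is étale at the point `x` if it is étale on an open neighbourhood of `x`. -/
def EtaleAtPt {X S : Scheme.{u}} (f : X ⟶ S) (x : X) : Prop :=
  ∃ U : X.Opens, x ∈ U ∧ IsEtale (U.ι ≫ f)

/-- `f` is flat at `x` if the induced map of stalks is flat. -/
def FlatAtPt {X S : Scheme.{u}} (f : X ⟶ S) (x : X) : Prop :=
  letI := (f.stalkMap x).hom.toAlgebra
  Module.Flat (S.presheaf.stalk (f.base x)) (X.presheaf.stalk x)

/-- A morphism of schemes is flat if it is flat at every point. -/
def SchemeFlat {X S : Scheme.{u}} (f : X ⟶ S) : Prop := ∀ x : X, FlatAtPt f x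

/-- The non-smooth locus of a morphism, as a set of points. -/
def NonSmoothLocus {X S : Scheme.{u}} (f : X ⟶ S) : Set X := {x | ¬ SmoothAtPt f x}

/-! ### Fibres -/

/-- The scheme-theoretic fibre `X_s` of `f : X ⟶ S` over `s ∈ S`. -/
def fiberScheme {X S : Scheme.{u}} (f : X ⟶ S) (s : S) : Scheme.{u} :=
  pullback f (S.fromSpecResidueField s)

/-- The projection from the fibre `X_s` to `X`. -/
def fiberι {X S : Scheme.{u}} (f : X ⟶ S) (s : S) : fiberScheme f s ⟶ X :=
  pullback.fst f (S.fromSpecResidueField s)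

/-- The structure morphism of the fibre `X_s` to the spectrum of the residue field. -/
def fiberRes {X S : Scheme.{u}} (f : X ⟶ S) (s : S) :
    fiberScheme f s ⟶ Spec (S.residueField s) :=
  pullback.snd f (S.fromSpecResidueField s)

/-- `f : X ⟶ S` has geometrically connected fibres. -/
def GeomConnFibers {X S : Scheme.{u}} (f : X ⟶ S) : Prop :=
  ∀ (K : Type u) [Field K] [IsAlgClosed K] (g : Spec (CommRingCat.of K) ⟶ S),
    ConnectedSpace ↑(pullback f g)

/-- A subset `T` of a scheme `Z` over (the spectrum of) a field object `k` is geometrically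
irreducible if its preimage in `Z ×_k K` is irreducible for every field extension `K` of `k`. -/
def GeomIrreducibleOver (k : CommRingCat.{u}) {Z : Scheme.{u}} (g : Z ⟶ Spec k)
    (T : Set Z) : Prop :=
  ∀ (K : Type u) [Field K] (ψ : k ⟶ CommRingCat.of K),
    IsIrreducible ((pullback.fst g (Spec.map ψ)).base ⁻¹' T)

/-! ### Standard local models `Spec R[x₁,…,xₙ]/(x₁⋯x_l − b)` and semistable morphisms -/

open MvPolynomial in
/-- The ring `R[x₁,…,xₙ]/(x₁⋯x_l − b)`. -/
abbrev stdRing (R : Type u) [CommRing R] (n l : ℕ) (b : R) : Type u :=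
  MvPolynomial (Fin n) R ⧸
    Ideal.span {(∏ i : Fin n, if (i : ℕ) < l then X i else 1) - C b}

/-- The standard local model as a scheme. -/
def stdScheme (R : Type u) [CommRing R] (n l : ℕ) (b : R) : Scheme.{u} :=
  Spec (CommRingCat.of (stdRing R n l b))

/-- The structure morphism of the standard local model. -/
def stdSpec (R : CommRingCat.{u}) (n l : ℕ) (b : R) : stdScheme ↥R n l b ⟶ Spec R :=
  Spec.map (CommRingCat.ofHom (algebraMap ↥R (stdRing ↥R n l b)))

open MvPolynomial in
/-- The class of the coordinate `x_i` in the standard model. -/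
def stdCoord (R : Type u) [CommRing R] (n l : ℕ) (b : R) (i : Fin n) : stdRing R n l b :=
  Ideal.Quotient.mk _ (X i)

/-- The data of a commutative diagram exhibiting `f` étale-locally at `x` as a standard
semistable model `Spec R[x₁,…,xₙ]/(x₁⋯x_l − b)`, as in the definition of a semistable
morphism. -/
structure ChartData {X S : Scheme.{u}} (f : X ⟶ S) (x : X) where
  R : CommRingCat.{u}
  n : ℕ
  l : ℕ
  hln : l ≤ n
  b : ↥R
  etS : Spec R ⟶ S
  etS_etale : IsEtale etS
  s' : ↑(Spec R)
  hs' : etS.base s' = f.base x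
  U : Scheme.{u}
  U_conn : ConnectedSpace ↑U
  gX : U ⟶ X
  gX_etale : IsEtale gX
  x' : ↑U
  hx' : gX.base x' = x
  gT : U ⟶ stdScheme ↥R n l b
  gT_etale : IsEtale gT
  comm : gT ≫ stdSpec R n l b ≫ etS = gX ≫ f

/-- A morphism is semistable if it is proper with geometrically connected fibres and admits
standard semistable charts étale-locally at every point. -/
def IsSemistable {X S : Scheme.{u}} (f : X ⟶ S) : Prop :=
  IsProper f ∧ GeomConnFibers f ∧ ∀ x : X, Nonempty (ChartData f x)

/-! ### Local rings: regularity, strict henselianity -/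

/-- The closed point of `Spec R` for a local ring `R` (with the local-ring witness passed
explicitly). -/
def closedPt (R : CommRingCat.{u}) (h : IsLocalRing ↥R) : ↑(Spec R) :=
  (@IsLocalRing.closedPoint ↥R _ h : PrimeSpectrum ↥R)

/-- A commutative ring is strictly henselian local if it is a henselian local ring with
separably closed residue field. -/
structure StrictlyHenselianLocal (A : Type u) [CommRing A] : Prop where
  toIsLocalRing : IsLocalRing A
  henselian : HenselianLocalRing A
  sepClosedResidue : @IsSepClosed (@IsLocalRing.ResidueField A _ toIsLocalRing)
      (@IsLocalRing.ResidueField.field A _ toIsLocalRing)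

/-- A Noetherian local ring is regular if its maximal ideal is generated by
`dim R` many elements. -/
def IsRegularLocal (A : Type u) [CommRing A] : Prop :=
  IsNoetherianRing A ∧ ∃ (h : IsLocalRing A) (s : Finset A),
    Ideal.span (s : Set A) = @IsLocalRing.maximalIdeal A _ h ∧
    (s.card : WithBot (WithTop ℕ)) = ringKrullDim A

/-- A scheme is regular if all its local rings are regular (and it is locally Noetherian). -/
def IsRegularScheme (X : Scheme.{u}) : Prop :=
  IsLocallyNoetherian X ∧ ∀ x : X, IsRegularLocal ↥(X.presheaf.stalk x)

/-! ### Labels of points of semistable morphisms over a local base -/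

/-- Over an affine base `Spec R`, the point `x` (of the non-smooth locus of its fibre) has
label `(b)`, `b ∈ R`, if there is a local chart
`U ⟶ Spec R[x₁,…,xₙ]/(x₁⋯x_l − b)` at `x` (with the coordinates `x₁,…,x_l` contained in
the prime ideal of the image of `x`).  Over a strictly henselian local ring this agrees
with the usual label in the strict henselisation. -/
def HasLabel {R : CommRingCat.{u}} {X : Scheme.{u}} (f : X ⟶ Spec R) (x : X) (b : ↥R) :
    Prop :=
  ∃ (n l : ℕ), l ≤ n ∧
    ∃ (U : Scheme.{u}) (gX : U ⟶ X) (x' : ↑U) (gT : U ⟶ stdScheme ↥R n l b),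
      IsEtale gX ∧ IsEtale gT ∧ gX.base x' = x ∧
      gT ≫ stdSpec R n l b = gX ≫ f ∧
      ∀ i : Fin n, (i : ℕ) < l → stdCoord ↥R n l b i ∈ (gT.base x').asIdeal

/-! ### Reduced closed subschemes and strata of fibres -/

/-- A realisation of the closed subset `C ⊆ X` as a reduced closed subscheme of `X`
(such a realisation always exists and is unique up to unique isomorphism). -/
structure ReducedClosedSubscheme (X : Scheme.{u}) (C : Set X) where
  Z : Scheme.{u}
  ι : Z ⟶ X
  isClosedImmersion : IsClosedImmersion ι
  reduced : IsReduced Z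
  range : Set.range ι.base = C

/-- `Sing` is the sequence of iterated non-smooth loci of a scheme `Z` over a field object
`k`: `Sing 0 = Z`, and `Sing (r+1)` is the non-smooth locus over `k` of `Sing r` endowed
with its reduced induced closed subscheme structure. -/
def IsSingSeq {k : CommRingCat.{u}} {Z : Scheme.{u}} (g : Z ⟶ Spec k)
    (Sing : ℕ → Set Z) : Prop :=
  Sing 0 = Set.univ ∧
  ∀ r : ℕ, ∃ W : ReducedClosedSubscheme Z (Sing r),
    Sing (r + 1) = W.ι.base '' {z | ¬ SmoothAtPt (W.ι ≫ g) z}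

/-- `T` is an `r`-stratum of the scheme `Z` over the field object `k`: an irreducible
component of the smooth locus of the `r`-th iterated non-smooth locus of `Z` over `k`. -/
def IsStratum {k : CommRingCat.{u}} {Z : Scheme.{u}} (g : Z ⟶ Spec k) (r : ℕ)
    (T : Set Z) : Prop :=
  ∃ Sing : ℕ → Set Z, IsSingSeq g Sing ∧
    ∃ W : ReducedClosedSubscheme Z (Sing r),
      ∃ T' ∈ irreducibleComponents {z : W.Z // SmoothAtPt (W.ι ≫ g) z},
        T = W.ι.base '' (Subtype.val '' T')

/-! ### Dual graphs, cycles and alignment over a local base -/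

/-- The (1-)stratum `T` of the closed fibre of `f` has label `b` (i.e. some — equivalently,
by constancy of labels, any — point of it has label `b`). -/
def StratumHasLabel {R : CommRingCat.{u}} {X : Scheme.{u}} (f : X ⟶ Spec R)
    (s : ↑(Spec R)) (T : Set (fiberScheme f s)) (b : ↥R) : Prop :=
  ∃ z ∈ T, HasLabel f ((fiberι f s).base z) b

/-- A cycle in the dual graph of the fibre of `f : X ⟶ Spec R` over the point `s`:
a cyclic sequence of pairwise distinct vertices (irreducible components of the fibre)
joined by pairwise distinct edges (1-strata, each contained in exactly the two
neighbouring components). -/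
structure GraphCycle {R : CommRingCat.{u}} {X : Scheme.{u}} (f : X ⟶ Spec R)
    (s : ↑(Spec R)) where
  N : ℕ
  hN : 0 < N
  v : Fin N → Set (fiberScheme f s)
  hv : ∀ i, v i ∈ irreducibleComponents ↑(fiberScheme f s)
  v_inj : Function.Injective v
  T : Fin N → Set (fiberScheme f s)
  hT : ∀ i, IsStratum (fiberRes f s) 1 (T i)
  T_inj : Function.Injective T
  incident : ∀ i : Fin N,
    {c ∈ irreducibleComponents ↑(fiberScheme f s) | T i ⊆ c} =
      {v i, v (⟨((i : ℕ) + 1) % N, Nat.mod_lt _ hN⟩ : Fin N)}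

/-- `f : X ⟶ Spec R` (for `R` local) is aligned at the closed point: for any cycle in the
dual graph of the closed fibre, the labels of any two of its edges admit equal positive
powers (as ideals of `R`). -/
def AlignedOver {R : CommRingCat.{u}} (hR : IsLocalRing ↥R) {X : Scheme.{u}}
    (f : X ⟶ Spec R) : Prop :=
  ∀ (c : GraphCycle f (closedPt R hR)) (i j : Fin c.N) (bi bj : ↥R),
    StratumHasLabel f (closedPt R hR) (c.T i) bi →
    StratumHasLabel f (closedPt R hR) (c.T j) bj →
    ∃ n m : ℕ, 0 < n ∧ 0 < m ∧ Ideal.span {bi} ^ n = Ideal.span {bj} ^ m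

/-- `f : X ⟶ S` is aligned (at every geometric point): the base change of `f` to any
Noetherian strictly henselian local test ring over `S` is aligned at the closed point.
(Taking the test ring to be a strict henselisation of a local ring of `S` recovers the
notion of alignment at a geometric point of `S`.) -/
def IsAligned {X S : Scheme.{u}} (f : X ⟶ S) : Prop :=
  ∀ (A : CommRingCat.{u}), IsNoetherianRing ↥A →
    ∀ (h : StrictlyHenselianLocal ↥A) (g : Spec A ⟶ S),
      AlignedOver h.toIsLocalRing (pullback.snd f g)

/-! ### The specialisation relation on irreducible components of fibres -/

/-- The irreducible component `Z` of the fibre `X_s` specialises (under `sp_{s→η}`) to the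
irreducible component `Y` of `X_η`, i.e. `Z` is contained in the fibre over `s` of the
closure of `Y` in `X`. -/
def spRel {X S : Scheme.{u}} (f : X ⟶ S) (s η : S)
    (Z : Set (fiberScheme f s)) (Y : Set (fiberScheme f η)) : Prop :=
  (fiberι f s).base '' Z ⊆ closure ((fiberι f η).base '' Y)

/-- `C` is a connected component of the subset `A` of a topological space. -/
def IsConnCompOf {α : Type u} [TopologicalSpace α] (A C : Set α) : Prop :=
  ∃ x : ↥A, C = Subtype.val '' connectedComponent x
/-! ### Orders of vanishing, Weil divisors and Cartier divisors -/

/-- `a` has order (length of `A/(a)` as an `A`-module, computed as the Krull dimension of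
the lattice of submodules) equal to `m`. -/
def elemOrd (A : Type u) [CommRing A] (a : A) (m : ℕ) : Prop :=
  Order.krullDim (Submodule A (A ⧸ Ideal.span {a})) = (m : ℕ∞)

/-- The order of vanishing of `a ∈ R` at the point `p` of `Spec R` is `k`. -/
def IsLocOrd {R : Type u} [CommRing R] (a : R) (p : PrimeSpectrum R) (k : ℕ) : Prop :=
  elemOrd (Localization (@Ideal.primeCompl R _ p.asIdeal p.2))
    (algebraMap R (Localization (@Ideal.primeCompl R _ p.asIdeal p.2)) a) k

/-- `z` is a divisorial point of `X`: its local ring has Krull dimension 1, i.e. the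
closure of `z` is a prime divisor on `X`. -/
def IsDivisorialPt (X : Scheme.{u}) (z : X) : Prop :=
  ringKrullDim ↥(X.presheaf.stalk z) = 1

/-- The order of vanishing at `z ∈ V` of the section `h ∈ Γ(X, V)` is `m`. -/
def germOrd {X : Scheme.{u}} (V : X.Opens) (h : Γ(X, V)) (z : X) (hz : z ∈ V)
    (m : ℕ) : Prop :=
  elemOrd ↥(X.presheaf.stalk z) (X.presheaf.germ V z hz h) m

/-- A Weil divisor on `X` is recorded as a coefficient function on points of `X`; only its
values at divisorial points are relevant. `CutsOn D V h₁ h₂` says that on the open set `V`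
the divisor `D` is cut out by the pair of nonzerodivisors `(h₁, h₂)` (i.e. `D` equals
`div h₁ − div h₂` on `V`). -/
def CutsOn {X : Scheme.{u}} (D : X → ℤ) (V : X.Opens) (h₁ h₂ : Γ(X, V)) : Prop :=
  h₁ ∈ nonZeroDivisors Γ(X, V) ∧ h₂ ∈ nonZeroDivisors Γ(X, V) ∧
  ∀ z (hz : z ∈ V), IsDivisorialPt X z →
    ∀ m₁ m₂ : ℕ, germOrd V h₁ z hz m₁ → germOrd V h₂ z hz m₂ →
      D z = (m₁ : ℤ) - (m₂ : ℤ)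

/-- The Weil divisor `D` is a Cartier divisor: it is cut out locally by ratios of
nonzerodivisor sections. -/
def IsCartierDiv {X : Scheme.{u}} (D : X → ℤ) : Prop :=
  ∀ x : X, ∃ V : X.Opens, x ∈ V ∧ ∃ h₁ h₂ : Γ(X, V), CutsOn D V h₁ h₂

/-- `D'` is the pullback along `p : W ⟶ X` of the Cartier divisor `D` on `X`: at every
divisorial point of `W`, the coefficient of `D'` is computed by pulling back local
equations of `D`. -/
def IsDivPullback {W X : Scheme.{u}} (p : W ⟶ X) (D : X → ℤ) (D' : W → ℤ) : Prop :=
  ∀ w : W, IsDivisorialPt W w →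
    ∀ (V : X.Opens) (hw : p.base w ∈ V) (h₁ h₂ : Γ(X, V)), CutsOn D V h₁ h₂ →
      ∀ m₁ m₂ : ℕ, germOrd (p ⁻¹ᵁ V) (p.app V h₁) w hw m₁ →
        germOrd (p ⁻¹ᵁ V) (p.app V h₂) w hw m₂ →
          D' w = (m₁ : ℤ) - (m₂ : ℤ)

/-- Two Weil divisors on `X` are linearly equivalent if their difference is the divisor of
a global ratio of nonzerodivisor sections. -/
def LinEquivDiv {X : Scheme.{u}} (D D' : X → ℤ) : Prop :=
  ∃ h₁ h₂ : Γ(X, ⊤), h₁ ∈ nonZeroDivisors Γ(X, ⊤) ∧ h₂ ∈ nonZeroDivisors Γ(X, ⊤) ∧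
    ∀ z : X, IsDivisorialPt X z →
      ∀ m₁ m₂ : ℕ, germOrd ⊤ h₁ z trivial m₁ → germOrd ⊤ h₂ z trivial m₂ →
        D z - D' z = (m₁ : ℤ) - (m₂ : ℤ)

/-! ### Group schemes over a base (group objects via generalized points) -/

/-- A group scheme over `S`: a scheme `G/S` together with multiplication, unit and
inverse morphisms satisfying the group axioms (expressed on generalized points). -/
structure GroupSchemeOver (S : Scheme.{u}) where
  G : Scheme.{u}
  π : G ⟶ S
  e : S ⟶ G
  e_sec : e ≫ π = 𝟙 S
  mul : pullback π π ⟶ G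
  mul_over : mul ≫ π = pullback.fst π π ≫ π
  inv : G ⟶ G
  inv_over : inv ≫ π = π
  mul_assoc' : ∀ {T : Scheme.{u}} (a b c : T ⟶ G) (hab : a ≫ π = b ≫ π)
    (hbc : b ≫ π = c ≫ π)
    (h₁ : (pullback.lift a b hab ≫ mul) ≫ π = c ≫ π)
    (h₂ : a ≫ π = (pullback.lift b c hbc ≫ mul) ≫ π),
    pullback.lift (pullback.lift a b hab ≫ mul) c h₁ ≫ mul =
      pullback.lift a (pullback.lift b c hbc ≫ mul) h₂ ≫ mul
  one_mul' : ∀ {T : Scheme.{u}} (a : T ⟶ G) (h : (a ≫ π ≫ e) ≫ π = a ≫ π),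
    pullback.lift (a ≫ π ≫ e) a h ≫ mul = a
  mul_one' : ∀ {T : Scheme.{u}} (a : T ⟶ G) (h : a ≫ π = (a ≫ π ≫ e) ≫ π),
    pullback.lift a (a ≫ π ≫ e) h ≫ mul = a
  inv_mul' : ∀ {T : Scheme.{u}} (a : T ⟶ G) (h : (a ≫ inv) ≫ π = a ≫ π),
    pullback.lift (a ≫ inv) a h ≫ mul = a ≫ π ≫ e
/-! ### Line bundles via Čech gluing data, and the relative Picard scheme -/

/-- A line bundle on a scheme `Y`, presented by Čech gluing data: an open cover together
with unit transition functions satisfying the cocycle condition. -/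
structure GluingData (Y : Scheme.{u}) where
  I : Type u
  U : I → Y.Opens
  covers : iSup U = ⊤
  t : ∀ i j : I, Γ(Y, U i ⊓ U j)
  t_isUnit : ∀ i j, IsUnit (t i j)
  cocycle : ∀ i j k : I,
    (Y.presheaf.map (homOfLE (inf_le_left : (U i ⊓ U j) ⊓ U k ≤ U i ⊓ U j)).op) (t i j) *
    (Y.presheaf.map (homOfLE (le_inf (inf_le_left.trans inf_le_right)
      (inf_le_right : (U i ⊓ U j) ⊓ U k ≤ U k))).op) (t j k) =
    (Y.presheaf.map (homOfLE (le_inf (inf_le_left.trans inf_le_left)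
      (inf_le_right : (U i ⊓ U j) ⊓ U k ≤ U k))).op) (t i k)

/-- The trivial line bundle. -/
def trivialGluing (Y : Scheme.{u}) : GluingData Y where
  I := PUnit
  U := fun _ => ⊤
  covers := by simp
  t := fun _ _ => 1
  t_isUnit := fun _ _ => isUnit_one
  cocycle := by intro i j k; simp

/-- `D'` is the pullback of the gluing data `D` along `φ : Z ⟶ Y`. -/
def IsPullbackGluing {Z Y : Scheme.{u}} (φ : Z ⟶ Y) (D : GluingData Y)
    (D' : GluingData Z) : Prop :=
  ∃ eqv : D.I ≃ D'.I,
    (∀ i, D'.U (eqv i) = φ ⁻¹ᵁ D.U i) ∧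
    ∀ (i j : D.I) (hle : D'.U (eqv i) ⊓ D'.U (eqv j) ≤ φ ⁻¹ᵁ (D.U i ⊓ D.U j)),
      D'.t (eqv i) (eqv j) =
        (Z.presheaf.map (homOfLE hle).op) ((φ.app (D.U i ⊓ D.U j)) (D.t i j))

/-- Two gluing data on `Y` present isomorphic line bundles: on a common refinement their
transition functions differ by a coboundary. -/
def GluingIso {Y : Scheme.{u}} (D₁ D₂ : GluingData Y) : Prop :=
  ∃ (K : Type u) (W : K → Y.Opens) (_ : iSup W = ⊤)
    (r₁ : K → D₁.I) (r₂ : K → D₂.I)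
    (_ : ∀ k, W k ≤ D₁.U (r₁ k)) (_ : ∀ k, W k ≤ D₂.U (r₂ k))
    (s : ∀ k, Γ(Y, W k)),
    (∀ k, IsUnit (s k)) ∧
    ∀ (k k' : K) (hle₁ : W k ⊓ W k' ≤ D₁.U (r₁ k) ⊓ D₁.U (r₁ k'))
      (hle₂ : W k ⊓ W k' ≤ D₂.U (r₂ k) ⊓ D₂.U (r₂ k')),
      (Y.presheaf.map (homOfLE hle₁).op) (D₁.t (r₁ k) (r₁ k')) *
        (Y.presheaf.map (homOfLE (inf_le_right : W k ⊓ W k' ≤ W k')).op) (s k') =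
      (Y.presheaf.map (homOfLE (inf_le_left : W k ⊓ W k' ≤ W k)).op) (s k) *
        (Y.presheaf.map (homOfLE hle₂).op) (D₂.t (r₂ k) (r₂ k'))

/-- `D₃` is (isomorphic to) the tensor product of the line bundles presented by `D₁` and
`D₂`: on a common refinement, its transition functions are the products of those of `D₁`
and `D₂`, up to a coboundary. -/
def TensorIso {Y : Scheme.{u}} (D₁ D₂ D₃ : GluingData Y) : Prop :=
  ∃ (K : Type u) (W : K → Y.Opens) (_ : iSup W = ⊤)
    (r₁ : K → D₁.I) (r₂ : K → D₂.I) (r₃ : K → D₃.I)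
    (_ : ∀ k, W k ≤ D₁.U (r₁ k)) (_ : ∀ k, W k ≤ D₂.U (r₂ k))
    (_ : ∀ k, W k ≤ D₃.U (r₃ k)) (s : ∀ k, Γ(Y, W k)),
    (∀ k, IsUnit (s k)) ∧
    ∀ (k k' : K) (hle₁ : W k ⊓ W k' ≤ D₁.U (r₁ k) ⊓ D₁.U (r₁ k'))
      (hle₂ : W k ⊓ W k' ≤ D₂.U (r₂ k) ⊓ D₂.U (r₂ k'))
      (hle₃ : W k ⊓ W k' ≤ D₃.U (r₃ k) ⊓ D₃.U (r₃ k')),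
      (Y.presheaf.map (homOfLE hle₃).op) (D₃.t (r₃ k) (r₃ k')) *
        (Y.presheaf.map (homOfLE (inf_le_right : W k ⊓ W k' ≤ W k')).op) (s k') =
      (Y.presheaf.map (homOfLE (inf_le_left : W k ⊓ W k' ≤ W k)).op) (s k) *
        ((Y.presheaf.map (homOfLE hle₁).op) (D₁.t (r₁ k) (r₁ k')) *
          (Y.presheaf.map (homOfLE hle₂).op) (D₂.t (r₂ k) (r₂ k')))

/-- An fppf cover: faithfully flat and locally of finite presentation. -/
def IsFppfCover {T' T : Scheme.{u}} (c : T' ⟶ T) : Prop :=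
  SchemeFlat c ∧ LocallyOfFinitePresentation c ∧ Function.Surjective c.base

/-- For `g : T ⟶ S` and `c : T' ⟶ T`, the induced morphism `X ×_S T' ⟶ X ×_S T`. -/
def inducedMap {X S T T' : Scheme.{u}} (f : X ⟶ S) (g : T ⟶ S) (c : T' ⟶ T) :
    pullback f (c ≫ g) ⟶ pullback f g :=
  pullback.map f (c ≫ g) f g (𝟙 X) c (𝟙 S) (by simp) (by simp)

/-- Data exhibiting a group scheme `P/S` as (a scheme representing) the relative Picard
functor `Pic_{X/S}`, i.e. the fppf sheafification of `T ↦ Pic(X ×_S T)`: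
a natural assignment `toPic` from line bundles on `X ×_S T` to `T`-points of `P`, which is
compatible with pullback, isomorphism and tensor products, sends the trivial bundle to the
unit section, and is fppf-locally bijective. -/
structure PicardData {X S : Scheme.{u}} (f : X ⟶ S) extends GroupSchemeOver S where
  lfp : LocallyOfFinitePresentation π
  toPic : ∀ {T : Scheme.{u}} (g : T ⟶ S), GluingData (pullback f g) → (T ⟶ G)
  toPic_over : ∀ {T : Scheme.{u}} (g : T ⟶ S) (D : GluingData (pullback f g)),
    toPic g D ≫ π = g
  toPic_trivial : ∀ {T : Scheme.{u}} (g : T ⟶ S),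
    toPic g (trivialGluing _) = g ≫ e
  toPic_pullback : ∀ {T T' : Scheme.{u}} (g : T ⟶ S) (c : T' ⟶ T)
    (D : GluingData (pullback f g)) (D' : GluingData (pullback f (c ≫ g))),
    IsPullbackGluing (inducedMap f g c) D D' → toPic (c ≫ g) D' = c ≫ toPic g D
  toPic_iso : ∀ {T : Scheme.{u}} (g : T ⟶ S) (D₁ D₂ : GluingData (pullback f g)),
    GluingIso D₁ D₂ → toPic g D₁ = toPic g D₂
  toPic_mul : ∀ {T : Scheme.{u}} (g : T ⟶ S) (D₁ D₂ D₃ : GluingData (pullback f g))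
    (_ : TensorIso D₁ D₂ D₃)
    (h : toPic g D₁ ≫ π = toPic g D₂ ≫ π),
    pullback.lift (toPic g D₁) (toPic g D₂) h ≫ mul = toPic g D₃
  locally_surjective : ∀ {T : Scheme.{u}} (g : T ⟶ S) (h : T ⟶ G), h ≫ π = g →
    ∃ (T' : Scheme.{u}) (c : T' ⟶ T), IsFppfCover c ∧
      ∃ D' : GluingData (pullback f (c ≫ g)), toPic (c ≫ g) D' = c ≫ h
  locally_injective : ∀ {T : Scheme.{u}} (g : T ⟶ S)
    (D₁ D₂ : GluingData (pullback f g)), toPic g D₁ = toPic g D₂ →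
    ∃ (T' : Scheme.{u}) (c : T' ⟶ T), IsFppfCover c ∧
      ∃ (D₁' D₂' : GluingData (pullback f (c ≫ g))) (E : GluingData T')
        (E' E₂ : GluingData (pullback f (c ≫ g))),
        IsPullbackGluing (inducedMap f g c) D₁ D₁' ∧
        IsPullbackGluing (inducedMap f g c) D₂ D₂' ∧
        IsPullbackGluing (pullback.snd f (c ≫ g)) E E' ∧
        TensorIso D₁' E' E₂ ∧ GluingIso E₂ D₂'

/-! ### `Pic⁰`, scheme-theoretic closures and Néron models -/

/-- The fibrewise identity component of a group scheme `P/S` over the open set `U ⊆ S`: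
the set of points lying over `U` and belonging to the connected component of the unit
section inside their fibre. -/
def pic0Set {S : Scheme.{u}} (P : GroupSchemeOver S) (U : S.Opens) : Set P.G :=
  {p | P.π.base p ∈ U ∧
    p ∈ connectedComponentIn (P.π.base ⁻¹' {P.π.base p}) (P.e.base (P.π.base p))}

/-- `(Z, ι)` is the scheme-theoretic closure (scheme-theoretic image) of `g : A ⟶ P`:
the smallest closed subscheme of `P` through which `g` factors. -/
structure IsSchClosure {A P : Scheme.{u}} (g : A ⟶ P) (Z : Scheme.{u}) (ι : Z ⟶ P) :
    Prop where
  isClosedImmersion : IsClosedImmersion ι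
  factors : ∃ g' : A ⟶ Z, g' ≫ ι = g
  smallest : ∀ (W : Scheme.{u}) (κ : W ⟶ P), IsClosedImmersion κ →
    (∃ w : A ⟶ W, w ≫ κ = g) → ∃ ρ : Z ⟶ W, ρ ≫ κ = ι

/-- A Néron model over `S` of a smooth "abelian" scheme `A` over the dense open `U ⊆ S`:
a smooth separated scheme `N/S` with an isomorphism `N ×_S U ≅ A` over `U`, satisfying
the Néron mapping property.  (The paper allows `N` to be an algebraic space; algebraic
spaces are not available in Mathlib, so schemes are used.) -/
structure NeronModelData {S : Scheme.{u}} (U : S.Opens) {A : Scheme.{u}}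
    (aU : A ⟶ U.toScheme) where
  N : Scheme.{u}
  ν : N ⟶ S
  smooth : IsSmooth ν
  separated : IsSeparated ν
  isoU : (ν ⁻¹ᵁ U).toScheme ≅ A
  isoU_over : isoU.hom ≫ aU = ν ∣_ U
  mapping : ∀ (T : Scheme.{u}) (t : T ⟶ S), IsSmooth t →
    ∀ (φU : (t ⁻¹ᵁ U).toScheme ⟶ A), φU ≫ aU = t ∣_ U →
      ∃! φ : T ⟶ N, φ ≫ ν = t ∧
        (t ⁻¹ᵁ U).ι ≫ φ = φU ≫ isoU.inv ≫ (ν ⁻¹ᵁ U).ι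

/-! ### Projective morphisms -/

attribute [local instance] MvPolynomial.gradedAlgebra

/-- Projective `n`-space (over `Spec (ULift ℤ)`). -/
def projSpace (n : ℕ) : Scheme.{u} :=
  Proj (MvPolynomial.homogeneousSubmodule (Fin (n + 1)) (ULift.{u} ℤ))

/-- Relative projective `n`-space over `S`. -/
def projSpaceOver (S : Scheme.{u}) (n : ℕ) : Scheme.{u} :=
  pullback (terminal.from (projSpace.{u} n)) (terminal.from S)

/-- A morphism is projective if it factors as a closed immersion into some relative
projective space over the base. -/
def IsProjectiveMorphism {X S : Scheme.{u}} (f : X ⟶ S) : Prop :=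
  ∃ (n : ℕ) (ι : X ⟶ projSpaceOver S n),
    IsClosedImmersion ι ∧ ι ≫ pullback.snd _ _ = f
end NeronSemistable
end


namespace NeronSemistable
open Polynomial

theorem henselian_section {R R' : Type*} [CommRing R] [HenselianLocalRing R] [CommRing R']
    [Algebra R R'] [Algebra.Etale R R'] (φ : R' →ₐ[R] IsLocalRing.ResidueField R) :
    ∃ σ : R' →ₐ[R] R, (IsScalarTower.toAlgHom R R (IsLocalRing.ResidueField R)).comp σ = φ := by
  have hp : (RingHom.ker φ.toRingHom).IsPrime := RingHom.ker_isPrime _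
  obtain ⟨f, hf, hst⟩ := Algebra.IsEtaleAt.exists_isStandardEtale (R := R) (RingHom.ker φ.toRingHom)
  obtain ⟨P⟩ := hst.nonempty_standardEtalePresentation
  have hu : IsUnit (φ f) := by
    rw [isUnit_iff_ne_zero]; exact hf
  let φ' : Localization.Away f →ₐ[R] IsLocalRing.ResidueField R :=
    IsLocalization.liftAlgHom (M := Submonoid.powers f) (f := φ) (by
      rintro ⟨_, n, rfl⟩; simpa using hu.pow n)
  have hφ' : φ'.comp (IsScalarTower.toAlgHom R R' _) = φ := by
    ext x; simp [φ']
  have hm : P.HasMap (φ' P.x) := P.hasMap.map φ'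
  obtain ⟨a₀, ha₀⟩ := IsLocalRing.residue_surjective (φ' P.x)
  have h1 : P.f.eval a₀ ∈ IsLocalRing.maximalIdeal R := by
    have := hm.1
    rw [← ha₀] at this
    rw [← IsLocalRing.residue_eq_zero_iff]
    rw [← this]
    change _ = aeval (algebraMap R (IsLocalRing.ResidueField R) a₀) P.f
    rw [aeval_algebraMap_apply]; simp
  have h2 : IsUnit (P.f.derivative.eval a₀) := by
    have := hm.isUnit_derivative_f
    rw [← ha₀] at this
    change IsUnit (aeval (algebraMap R (IsLocalRing.ResidueField R) a₀) P.f.derivative) at this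
    rw [aeval_algebraMap_apply] at this
    simpa using this
  obtain ⟨a, ha, haa⟩ := HenselianLocalRing.is_henselian P.f P.monic_f a₀ h1 h2
  have hres : algebraMap R (IsLocalRing.ResidueField R) a = φ' P.x := by
    rw [← ha₀]
    have := (IsLocalRing.residue_eq_zero_iff _).2 haa
    rw [map_sub, sub_eq_zero] at this
    exact this
  have hma : P.HasMap a := by
    refine ⟨by simpa using ha, ?_⟩
    have := hm.2
    rw [← hres, aeval_algebraMap_apply] at this
    simpa using this
  let σ' : Localization.Away f →ₐ[R] R := (P.lift a hma).comp P.equivRing.toAlgHom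
  refine ⟨σ'.comp (IsScalarTower.toAlgHom R R' _), ?_⟩
  rw [← hφ', ← AlgHom.comp_assoc]
  congr 1
  apply P.hom_ext
  simpa [σ'] using hres

theorem henselian_factor {R : Type*} [CommRing R] [HenselianLocalRing R]
    (p : R[X]) (hp : p.Monic) (f g : (IsLocalRing.ResidueField R)[X])
    (hf : f.Monic) (hg : g.Monic) (hfg : IsCoprime f g)
    (h : f * g = p.map (IsLocalRing.residue R)) :
    ∃ F G : R[X], F.Monic ∧ G.Monic ∧ F * G = p ∧ F.map (IsLocalRing.residue R) = f ∧
      G.map (IsLocalRing.residue R) = g := by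
  have hn : p.natDegree = f.natDegree + g.natDegree := by
    rw [← hf.natDegree_mul hg, h, hp.natDegree_map]
  let p' : MonicDegreeEq R p.natDegree := MonicDegreeEq.mk p hp rfl
  let f' : MonicDegreeEq (IsLocalRing.ResidueField R) f.natDegree := MonicDegreeEq.mk f hf rfl
  let g' : MonicDegreeEq (IsLocalRing.ResidueField R) g.natDegree := MonicDegreeEq.mk g hg rfl
  let e := UniversalCoprimeFactorizationRing.homEquiv (IsLocalRing.ResidueField R)
    f.natDegree g.natDegree hn p'
  let φ := e.symm ⟨(f', g'), h, hfg⟩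
  obtain ⟨σ, hσ⟩ := henselian_section φ
  let q := UniversalCoprimeFactorizationRing.homEquiv R f.natDegree g.natDegree hn p' σ
  have h1 := UniversalCoprimeFactorizationRing.homEquiv_comp_fst R f.natDegree g.natDegree hn p' σ
    (IsScalarTower.toAlgHom R R (IsLocalRing.ResidueField R))
  have h2 := UniversalCoprimeFactorizationRing.homEquiv_comp_snd R f.natDegree g.natDegree hn p' σ
    (IsScalarTower.toAlgHom R R (IsLocalRing.ResidueField R))
  have h3 : e φ = ⟨(f', g'), h, hfg⟩ := e.apply_symm_apply _
  rw [hσ] at h1 h2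
  change (e φ).1.1 = _ at h1
  change (e φ).1.2 = _ at h2
  rw [h3] at h1 h2
  refine ⟨q.1.1.1, q.1.2.1, q.1.1.monic, q.1.2.monic, ?_, ?_, ?_⟩
  · have := q.2.1
    exact this.trans Polynomial.map_id
  · exact (congrArg Subtype.val h1).symm
  · exact (congrArg Subtype.val h2).symm

/-- An integral domain extension of a henselian local ring is local. -/
theorem isLocalRing_of_integral (R : Type*) {A : Type*} [CommRing R] [HenselianLocalRing R] [CommRing A]
    [IsDomain A] [Algebra R A] [Algebra.IsIntegral R A] : IsLocalRing A := by
  have key : ∀ m₁ m₂ : Ideal A, m₁.IsMaximal → m₂.IsMaximal → m₁ ≤ m₂ := by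
    intro m₁ m₂ h₁ h₂ a ha
    by_contra ha2
    have hc : ∀ m : Ideal A, m.IsMaximal → m.comap (algebraMap R A) = IsLocalRing.maximalIdeal R := by
      intro m hm
      exact IsLocalRing.eq_maximalIdeal (Ideal.isMaximal_comap_of_isIntegral_of_isMaximal m)
    obtain ⟨p, hp, hpa⟩ := Algebra.IsIntegral.isIntegral (R := R) a
    set pb := p.map (IsLocalRing.residue R) with hpb
    have hpb0 : pb ≠ 0 := (hp.map _).ne_zero
    obtain ⟨h, hh, hnd⟩ := Polynomial.exists_eq_pow_rootMultiplicity_mul_and_not_dvd pb hpb0 0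
    set i := pb.rootMultiplicity 0
    rw [C_0, sub_zero] at hh hnd
    have hXm : (X ^ i : (IsLocalRing.ResidueField R)[X]).Monic := monic_X_pow i
    have hhm : h.Monic := by
      refine Monic.of_mul_monic_left hXm ?_
      rw [← hh]; exact hp.map _
    have hcop : IsCoprime (X ^ i) h := by
      apply IsCoprime.pow_left
      exact (Polynomial.irreducible_X.coprime_iff_not_dvd).2 hnd
    obtain ⟨F, G, hF, hG, hFG, hFm, hGm⟩ := henselian_factor p hp _ _ hXm hhm hcop hh.symm
    have hz : aeval a F * aeval a G = 0 := by
      rw [← map_mul, hFG]; exact hpa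
    rcases mul_eq_zero.1 hz with h0 | h0
    · -- `a ^ i` in `m₂`
      have : (Ideal.Quotient.mk m₂ a) ^ i = 0 := by
        have e1 : F - X ^ i ∈ Ideal.map C (IsLocalRing.maximalIdeal R) := by
          rw [Ideal.mem_map_C_iff]
          intro n
          rw [← IsLocalRing.residue_eq_zero_iff, ← coeff_map, Polynomial.map_sub, hFm]
          simp
        have e2 : aeval a (F - X ^ i) ∈ m₂ := by
          have : Ideal.map C (IsLocalRing.maximalIdeal R) ≤ m₂.comap (aeval (R := R) a).toRingHom := by
            rw [Ideal.map_le_iff_le_comap]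
            intro r hr
            rw [← hc m₂ h₂] at hr
            simpa using hr
          exact this e1
        rw [map_sub, h0, zero_sub, neg_mem_iff, map_pow, aeval_X] at e2
        rw [← map_pow]; exact Ideal.Quotient.eq_zero_iff_mem.2 e2
      rw [← map_pow, Ideal.Quotient.eq_zero_iff_mem] at this
      exact ha2 (h₂.isPrime.mem_of_pow_mem _ this)
    · have : G.coeff 0 ∈ IsLocalRing.maximalIdeal R := by
        rw [← hc m₁ h₁, Ideal.mem_comap]
        have := Polynomial.X_mul_divX_add G
        have h3 : aeval a G = a * aeval a G.divX + algebraMap R A (G.coeff 0) := by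
          have h5 := congrArg (aeval a) this
          rw [← h5, map_add, map_mul, aeval_X, aeval_C]
        rw [h0] at h3
        have h4 : algebraMap R A (G.coeff 0) = -(a * aeval a G.divX) := by
          linear_combination -h3
        rw [h4]
        exact m₁.neg_mem (m₁.mul_mem_right _ ha)
      rw [← IsLocalRing.residue_eq_zero_iff, ← coeff_map, hGm] at this
      exact hnd (X_dvd_iff.2 this)
  obtain ⟨m, hm⟩ := Ideal.exists_maximal A
  refine IsLocalRing.of_unique_max_ideal ⟨m, hm, fun m' hm' => ?_⟩
  exact le_antisymm (key _ _ hm' hm) (key _ _ hm hm')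

end NeronSemistable


set_option linter.style.haveILetI false
set_option linter.unusedSectionVars false
namespace NeronSemistable
open Polynomial TensorProduct

section etaleNormal
variable {A B : Type*} [CommRing A] [IsDomain A] [CommRing B] [Algebra A B]

theorem includeLeft_inj [Module.Flat A B] :
    Function.Injective (algebraMap B (B ⊗[A] FractionRing A)) :=
  Algebra.TensorProduct.includeLeft_injective (S := B) (IsFractionRing.injective A (FractionRing A))

theorem tensor_frac_repr (x : B ⊗[A] FractionRing A) :
    ∃ (b : B) (a : A), a ≠ 0 ∧ (algebraMap A (B ⊗[A] FractionRing A) a) * x = algebraMap B _ b := by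
  induction x with
  | zero => exact ⟨0, 1, one_ne_zero, by simp⟩
  | tmul b k =>
    obtain ⟨n, d, hd, rfl⟩ := IsFractionRing.div_surjective (A := A) k
    refine ⟨n • b, d, nonZeroDivisors.ne_zero hd, ?_⟩
    have hd0 : algebraMap A (FractionRing A) d ≠ 0 :=
      (map_ne_zero_iff _ (IsFractionRing.injective A _)).2 (nonZeroDivisors.ne_zero hd)
    rw [← Algebra.smul_def, TensorProduct.smul_tmul', TensorProduct.smul_tmul]
    rw [Algebra.smul_def, mul_div_cancel₀ _ hd0, Algebra.algebraMap_eq_smul_one,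
      ← TensorProduct.smul_tmul]
    rfl
  | add x y hx hy =>
    obtain ⟨b, a, ha, h⟩ := hx
    obtain ⟨b', a', ha', h'⟩ := hy
    refine ⟨a' • b + a • b', a * a', mul_ne_zero ha ha', ?_⟩
    simp only [Algebra.smul_def, map_add, map_mul, ← h, ← h', ← IsScalarTower.algebraMap_apply A B]
    ring

theorem integral_mem_of_etale [IsIntegrallyClosed A] [Algebra.Etale A B]
    (x : B ⊗[A] FractionRing A) (hx : IsIntegral B x) :
    ∃ b : B, algebraMap B _ b = x := by
  obtain ⟨y, hy⟩ := (TensorProduct.toIntegralClosure_bijective_of_smooth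
    (R := A) (S := B) (B := FractionRing A)).2 ⟨x, hx⟩
  have hy' : x = (TensorProduct.toIntegralClosure A B (FractionRing A) y : B ⊗[A] FractionRing A) := by
    rw [hy]
  rw [hy']
  clear hy' hy
  induction y with
  | zero => exact ⟨0, by simp⟩
  | tmul b k =>
    obtain ⟨a, ha⟩ := (IsIntegrallyClosed.isIntegral_iff (R := A) (K := FractionRing A)).1 k.2
    refine ⟨a • b, ?_⟩
    have : (TensorProduct.toIntegralClosure A B (FractionRing A) (b ⊗ₜ k) : B ⊗[A] FractionRing A)
      = b ⊗ₜ (k : FractionRing A) := by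
      simp [TensorProduct.toIntegralClosure]
    rw [this, ← ha, Algebra.algebraMap_eq_smul_one (A := FractionRing A), ← TensorProduct.smul_tmul]
    rfl
  | add x y hx hy =>
    obtain ⟨b, h⟩ := hx
    obtain ⟨b', h'⟩ := hy
    exact ⟨b + b', by rw [map_add, map_add, h, h']; rfl⟩

theorem etale_vonNeumann {K E : Type*} [Field K] [CommRing E] [Algebra K E] [Algebra.Etale K E]
    (c : E) : ∃ w, c * c * w = c := by
  obtain ⟨I, _, Ai, _, _, e, _⟩ := (Algebra.Etale.iff_exists_algEquiv_prod K E).1 inferInstance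
  refine ⟨e.symm (fun i => (e c i)⁻¹), ?_⟩
  apply e.injective
  ext i
  simp only [map_mul, AlgEquiv.apply_symm_apply, Pi.mul_apply]
  by_cases h : e c i = 0
  · simp [h]
  · field_simp

theorem etale_core [IsIntegrallyClosed A] [Algebra.Etale A B] (c : B) :
    ∃ (e : B) (a : A) (ε : B), a ≠ 0 ∧ e * e = e ∧ e * c = c ∧ algebraMap A B a * e = c * ε := by
  let E := B ⊗[A] FractionRing A
  letI : Algebra (FractionRing A) E := Algebra.TensorProduct.rightAlgebra
  haveI : Algebra.Etale (FractionRing A) E :=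
    Algebra.Etale.of_equiv (Algebra.TensorProduct.commRight A (FractionRing A) B)
  obtain ⟨w, hw⟩ := etale_vonNeumann (K := FractionRing A) (algebraMap B E c)
  have hid : (algebraMap B E c * w) * (algebraMap B E c * w) = algebraMap B E c * w := by
    linear_combination w * hw
  obtain ⟨e, he⟩ := integral_mem_of_etale (A := A) (algebraMap B E c * w) (by
    refine ⟨X ^ 2 - X, by monicity!, ?_⟩
    rw [eval₂_sub, eval₂_pow, eval₂_X, sq, hid, sub_self])
  obtain ⟨ε, a, ha, hε⟩ := tensor_frac_repr (A := A) w
  refine ⟨e, a, ε, ha, ?_, ?_, ?_⟩ <;> apply includeLeft_inj (A := A) (B := B)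
  · rw [map_mul, he, hid]
  · rw [map_mul, he]; linear_combination hw
  · rw [map_mul, map_mul, he, ← IsScalarTower.algebraMap_apply, ← hε]; ring

theorem flat_nzd [Module.Flat A B] {a : A} (ha : a ≠ 0) {b : B} (h : algebraMap A B a * b = 0) :
    b = 0 := by
  apply includeLeft_inj (A := A) (B := B)
  rw [map_zero]
  have h2 : algebraMap (FractionRing A) (FractionRing A) (algebraMap A _ a)⁻¹ * algebraMap A _ a = 1 := by
    simp; exact inv_mul_cancel₀ ((map_ne_zero_iff _ (IsFractionRing.injective A _)).2 ha)
  have h3 : ((1 : B) ⊗ₜ[A] (algebraMap A (FractionRing A) a)⁻¹) * (algebraMap B _ (algebraMap A B a * b)) = algebraMap B (B ⊗[A] FractionRing A) b := by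
    rw [Algebra.TensorProduct.algebraMap_apply, Algebra.TensorProduct.algebraMap_apply]
    simp only [Algebra.algebraMap_self, RingHom.id_apply]
    rw [Algebra.TensorProduct.tmul_mul_tmul, ← Algebra.smul_def, one_mul, TensorProduct.smul_tmul,
      Algebra.smul_def, mul_one, mul_comm]
    simp only [Algebra.algebraMap_self, RingHom.id_apply] at h2
    rw [h2]
  rw [← h3, h, map_zero, mul_zero]

theorem etale_local_dichotomy [IsIntegrallyClosed A] [Algebra.Etale A B] (P : Ideal B) [P.IsPrime]
    (c : B) : (∃ t ∉ P, t * c = 0) ∨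
      ∃ (e : B) (a : A) (ε : B), a ≠ 0 ∧ e ∉ P ∧ algebraMap A B a * e = c * ε := by
  obtain ⟨e, a, ε, ha, hee, hec, h⟩ := etale_core (A := A) c
  by_cases he : e ∈ P
  · refine .inl ⟨1 - e, fun h1 => ?_, by linear_combination -hec⟩
    exact ‹P.IsPrime›.ne_top ((Ideal.eq_top_iff_one _).2 (by simpa using P.add_mem h1 he))
  · exact .inr ⟨e, a, ε, ha, he, h⟩

/-- the local rings of an étale algebra over a normal domain are domains. -/
theorem etale_local_mul [IsIntegrallyClosed A] [Algebra.Etale A B] (P : Ideal B) [P.IsPrime]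
    (c d : B) (h : ∃ t ∉ P, t * (c * d) = 0) : (∃ t ∉ P, t * c = 0) ∨ (∃ t ∉ P, t * d = 0) := by
  obtain ⟨t, ht, htc⟩ := h
  rcases etale_local_dichotomy (A := A) P c with h1 | ⟨e, a, ε, ha, he, h1⟩
  · exact .inl h1
  rcases etale_local_dichotomy (A := A) P d with h2 | ⟨e', a', ε', ha', he', h2⟩
  · exact .inr h2
  exfalso
  have : algebraMap A B (a * a') * (t * e * e') = 0 := by
    rw [map_mul]
    linear_combination t * algebraMap A B a' * e' * h1 + t * c * ε * h2 + ε * ε' * htc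
  have := flat_nzd (mul_ne_zero ha ha') this
  exact ‹P.IsPrime›.mul_notMem (‹P.IsPrime›.mul_notMem ht he) he' (this ▸ P.zero_mem)

theorem etale_exists_min_prime [IsIntegrallyClosed A] [Algebra.Etale A B] (P : Ideal B)
    [P.IsPrime] : ∃ P₀ : Ideal B, P₀.IsPrime ∧ ∀ P' : Ideal B, P'.IsPrime → P' ≤ P → P₀ ≤ P' := by
  refine ⟨RingHom.ker (algebraMap B (Localization.AtPrime P)), ?_, ?_⟩
  · have hk : ∀ c, c ∈ RingHom.ker (algebraMap B (Localization.AtPrime P)) ↔ ∃ t ∉ P, t * c = 0 := by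
      intro c
      rw [RingHom.mem_ker, IsLocalization.map_eq_zero_iff P.primeCompl]
      simp [Ideal.primeCompl]
    refine ⟨?_, ?_⟩
    · exact RingHom.ker_ne_top _
    · intro x y hxy
      rw [hk] at *
      rw [hk]
      exact etale_local_mul (A := A) P x y hxy
  · intro P' hP' hle c hc
    rw [RingHom.mem_ker, IsLocalization.map_eq_zero_iff P.primeCompl] at hc
    obtain ⟨⟨t, ht⟩, htc⟩ := hc
    have : t * c ∈ P' := htc ▸ P'.zero_mem
    exact (hP'.mem_or_mem this).resolve_left (fun h => ht (hle h))

theorem etale_isDomain_localization [IsIntegrallyClosed A] [Algebra.Etale A B] (P : Ideal B)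
    [P.IsPrime] : IsDomain (Localization.AtPrime P) := by
  haveI : NoZeroDivisors (Localization.AtPrime P) := by
    refine ⟨fun {x y} hxy => ?_⟩
    obtain ⟨c, s, rfl⟩ := IsLocalization.exists_mk'_eq P.primeCompl x
    obtain ⟨d, s', rfl⟩ := IsLocalization.exists_mk'_eq P.primeCompl y
    rw [← IsLocalization.mk'_mul, IsLocalization.mk'_eq_zero_iff] at hxy
    rw [IsLocalization.mk'_eq_zero_iff, IsLocalization.mk'_eq_zero_iff]
    obtain ⟨⟨t, ht⟩, h⟩ := hxy
    rcases etale_local_mul (A := A) P c d ⟨t, ht, h⟩ with ⟨t, ht, h⟩ | ⟨t, ht, h⟩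
    · exact .inl ⟨⟨t, ht⟩, h⟩
    · exact .inr ⟨⟨t, ht⟩, h⟩
  exact NoZeroDivisors.to_isDomain _

theorem etale_eq_zero_of_mem [IsIntegrallyClosed A] [Algebra.Etale A B] (P : Ideal B)
    [P.IsPrime] (q : Ideal B) [hq : q.IsPrime] (hqP : q ≤ P) (hqA : q.comap (algebraMap A B) = ⊥)
    (c : B) (hc : c ∈ q) : algebraMap B (Localization.AtPrime P) c = 0 := by
  rw [IsLocalization.map_eq_zero_iff P.primeCompl]
  rcases etale_local_dichotomy (A := A) P c with ⟨t, ht, h⟩ | ⟨e, a, ε, ha, he, h1⟩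
  · exact ⟨⟨t, ht⟩, h⟩
  · exfalso
    have : algebraMap A B a * e ∈ q := h1 ▸ q.mul_mem_right _ hc
    rcases hq.mem_or_mem this with h | h
    · have : a ∈ q.comap (algebraMap A B) := h
      rw [hqA] at this
      exact ha this
    · exact he (hqP h)

theorem etale_isIntegrallyClosed_localization [IsIntegrallyClosed A] [Algebra.Etale A B]
    (P : Ideal B) [P.IsPrime] : IsIntegrallyClosed (Localization.AtPrime P) := by
  haveI := etale_isDomain_localization (A := A) P
  let D := Localization.AtPrime P
  let L := FractionRing D
  rw [isIntegrallyClosed_iff L]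
  intro f hf
  have hBL : ∀ b : B, algebraMap B L b = 0 → ∃ u ∉ P, u * b = 0 := by
    intro b hb
    rw [IsScalarTower.algebraMap_apply B D L, map_eq_zero_iff _ (IsFractionRing.injective D L),
      IsLocalization.map_eq_zero_iff P.primeCompl] at hb
    obtain ⟨⟨u, hu⟩, h⟩ := hb
    exact ⟨u, hu, h⟩
  have hnP : ∀ u ∉ P, algebraMap B L u ≠ 0 := by
    intro u hu h
    obtain ⟨v, hv, h⟩ := hBL u h
    exact ‹P.IsPrime›.mul_notMem hv hu (h ▸ P.zero_mem)
  have hA : ∀ a : A, a ≠ 0 → algebraMap A L a ≠ 0 := by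
    intro a ha h
    rw [IsScalarTower.algebraMap_apply A B L] at h
    obtain ⟨u, hu, h⟩ := hBL _ h
    rw [mul_comm] at h
    exact hu (flat_nzd ha h ▸ P.zero_mem)
  -- write `f` as `y / a`
  obtain ⟨y, a, v, ha, hv, hy⟩ : ∃ (y : B) (a : A) (v : B), a ≠ 0 ∧ v ∉ P ∧
      algebraMap A L a * algebraMap B L v * f = algebraMap B L y := by
    obtain ⟨x, z, hz, rfl⟩ := IsFractionRing.div_surjective (A := D) f
    obtain ⟨g, s, rfl⟩ := IsLocalization.exists_mk'_eq P.primeCompl x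
    obtain ⟨h, s', rfl⟩ := IsLocalization.exists_mk'_eq P.primeCompl z
    have hz0 := nonZeroDivisors.ne_zero hz
    rcases etale_local_dichotomy (A := A) P h with ⟨t, ht, h1⟩ | ⟨e, a, ε, ha, he, h1⟩
    · exact absurd ((IsLocalization.mk'_eq_zero_iff _ _).2 ⟨⟨t, ht⟩, h1⟩) hz0
    · refine ⟨g * ε * s', a, e * s, ha, ‹P.IsPrime›.mul_notMem he s.2, ?_⟩
      have e1 : algebraMap D L (IsLocalization.mk' D g s) * algebraMap B L s = algebraMap B L g := by
        rw [IsScalarTower.algebraMap_apply B D L, IsScalarTower.algebraMap_apply B D L, ← map_mul,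
          IsLocalization.mk'_spec]
      have e2 : algebraMap D L (IsLocalization.mk' D h s') * algebraMap B L s' = algebraMap B L h := by
        rw [IsScalarTower.algebraMap_apply B D L, IsScalarTower.algebraMap_apply B D L, ← map_mul,
          IsLocalization.mk'_spec]
      have hne : algebraMap D L (IsLocalization.mk' D h s') ≠ 0 :=
        (map_ne_zero_iff _ (IsFractionRing.injective D L)).2 hz0
      have e3 := congrArg (algebraMap B L) h1
      simp only [map_mul, ← IsScalarTower.algebraMap_apply A B L] at e3 ⊢
      rw [mul_div_assoc', div_eq_iff hne]
      rw [← e1]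
      linear_combination (algebraMap D L (IsLocalization.mk' D g s) * algebraMap B L s) * e3 -
        algebraMap D L (IsLocalization.mk' D g s) * algebraMap B L s * algebraMap B L ε * e2
  obtain ⟨⟨t, ht⟩, hti⟩ := IsIntegral.exists_multiple_integral_of_isLocalization P.primeCompl f hf
  -- the integral element
  have hti' : IsIntegral B (algebraMap B L (v * t) * f) := by
    rw [map_mul, mul_assoc]
    refine (isIntegral_algebraMap).mul ?_
    simpa [Algebra.smul_def, Submonoid.smul_def] using hti
  obtain ⟨q, hq, hq0⟩ := hti'
  have hmap : ∀ a ∈ nonZeroDivisors A, IsUnit (algebraMap A L a) := fun a ha =>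
    (hA a (nonZeroDivisors.ne_zero ha)).isUnit
  let ψ : FractionRing A →ₐ[A] L := IsLocalization.liftAlgHom (M := nonZeroDivisors A)
    (f := Algebra.ofId A L) (fun a => hmap _ a.2)
  let θ : B ⊗[A] FractionRing A →ₐ[B] L :=
    Algebra.TensorProduct.lift (Algebra.ofId B L) ψ (fun _ _ => Commute.all _ _)
  let ξ : B ⊗[A] FractionRing A := (t * y) ⊗ₜ (algebraMap A (FractionRing A) a)⁻¹
  have haK : algebraMap A (FractionRing A) a ≠ 0 :=
    (map_ne_zero_iff _ (IsFractionRing.injective A _)).2 ha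
  have hξa : algebraMap A (B ⊗[A] FractionRing A) a * ξ = algebraMap B _ (t * y) := by
    rw [← Algebra.smul_def, TensorProduct.smul_tmul', TensorProduct.smul_tmul, Algebra.smul_def,
      mul_inv_cancel₀ haK]
    rfl
  have hθξ : θ ξ = algebraMap B L (v * t) * f := by
    have h1 := congrArg θ hξa
    rw [map_mul, AlgHom.commutes, IsScalarTower.algebraMap_apply A B (B ⊗[A] FractionRing A),
      AlgHom.commutes, ← IsScalarTower.algebraMap_apply A B L, map_mul, ← hy] at h1
    apply mul_left_cancel₀ (hA a ha)
    rw [h1, map_mul]; ring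
  obtain ⟨β, a', ha', hβ⟩ := tensor_frac_repr (A := A) (eval₂ (algebraMap B _) ξ q)
  have hβ0 : algebraMap B L β = 0 := by
    have h1 := congrArg θ hβ
    rw [map_mul, AlgHom.commutes] at h1
    rw [← h1]
    have : θ (eval₂ (algebraMap B _) ξ q) = 0 := by
      rw [← hq0, ← hθξ]
      exact (Polynomial.hom_eval₂ q (algebraMap B _) θ.toRingHom ξ).trans (by
        congr 1; exact θ.comp_algebraMap)
    rw [this, mul_zero]
  obtain ⟨u, hu, huβ⟩ := hBL β hβ0
  have huq : algebraMap B (B ⊗[A] FractionRing A) u * eval₂ (algebraMap B _) ξ q = 0 := by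
    obtain ⟨i, hi⟩ : ∃ i, i * algebraMap A (B ⊗[A] FractionRing A) a' = 1 := by
      refine ⟨1 ⊗ₜ (algebraMap A (FractionRing A) a')⁻¹, ?_⟩
      rw [mul_comm, ← Algebra.smul_def, TensorProduct.smul_tmul', TensorProduct.smul_tmul,
        Algebra.smul_def, mul_inv_cancel₀
        ((map_ne_zero_iff _ (IsFractionRing.injective A (FractionRing A))).2 ha')]
      rfl
    have h2 := congrArg (algebraMap B (B ⊗[A] FractionRing A)) huβ
    rw [map_mul, map_zero, ← hβ] at h2
    linear_combination i * h2 - (algebraMap B (B ⊗[A] FractionRing A) u *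
      eval₂ (algebraMap B (B ⊗[A] FractionRing A)) ξ q) * hi
  have hdeg : q.natDegree ≠ 0 := by
    intro h0
    rw [hq.natDegree_eq_zero.1 h0] at hq0
    simp at hq0
  have hInteg : IsIntegral B (algebraMap B (B ⊗[A] FractionRing A) u * ξ) := by
    refine ⟨q.scaleRoots u, (monic_scaleRoots_iff u).2 hq, ?_⟩
    rw [scaleRoots_eval₂_mul]
    obtain ⟨k, hk⟩ := Nat.exists_eq_succ_of_ne_zero hdeg
    rw [hk, pow_succ, mul_assoc, huq, mul_zero]
  obtain ⟨z, hz⟩ := integral_mem_of_etale _ hInteg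
  refine ⟨IsLocalization.mk' D z (⟨u * (v * t), ‹P.IsPrime›.mul_notMem hu
    (‹P.IsPrime›.mul_notMem hv ht)⟩ : P.primeCompl), ?_⟩
  have h3 := congrArg θ hz
  rw [map_mul, AlgHom.commutes, AlgHom.commutes, hθξ] at h3
  have h4 : algebraMap B L (u * (v * t)) ≠ 0 := hnP _ (‹P.IsPrime›.mul_notMem hu
    (‹P.IsPrime›.mul_notMem hv ht))
  apply mul_right_cancel₀ h4
  rw [IsScalarTower.algebraMap_apply B D L, ← map_mul]
  have := IsLocalization.mk'_spec D z (⟨u * (v * t), ‹P.IsPrime›.mul_notMem hu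
    (‹P.IsPrime›.mul_notMem hv ht)⟩ : P.primeCompl)
  simp only at this
  rw [this, ← IsScalarTower.algebraMap_apply B D L, ← IsScalarTower.algebraMap_apply B D L, h3]
  simp only [map_mul]
  ring

end etaleNormal
end NeronSemistable

set_option linter.style.haveILetI false
set_option linter.unusedSectionVars false
namespace NeronSemistable
open Polynomial

section node
variable {C : Type*} [CommRing C]

local notation "L" => LaurentPolynomial C

theorem node_trunc (b : C) (q : C[X]) :
    LaurentPolynomial.trunc ((LaurentPolynomial.C b * LaurentPolynomial.T (-1) : L) *
      aeval (LaurentPolynomial.C b * LaurentPolynomial.T (-1) : L) q) = 0 := by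
  induction q using Polynomial.induction_on' with
  | add p q hp hq => rw [map_add, mul_add, map_add, hp, hq, add_zero]
  | monomial n a =>
    rw [aeval_monomial, ← LaurentPolynomial.C_eq_algebraMap]
    have : (LaurentPolynomial.C b * LaurentPolynomial.T (-1) : L) *
      (LaurentPolynomial.C a * (LaurentPolynomial.C b * LaurentPolynomial.T (-1)) ^ n) =
      LaurentPolynomial.C (b ^ (n+1) * a) * LaurentPolynomial.T (-(n + 1)) := by
      have h : (LaurentPolynomial.T (-(n + 1)) : L) = LaurentPolynomial.T (-1) ^ (n + 1) := by
        rw [LaurentPolynomial.T_pow]; congr 1; push_cast; ring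
      rw [h, map_mul, map_pow]; ring
    rw [this, LaurentPolynomial.trunc_C_mul_T, if_neg (by omega)]

theorem node_inj [IsDomain C] {b : C} (hb : b ≠ 0) {T : Type*} [CommRing T] [Algebra C T] (x y : T)
    (NF : ∀ t : T, ∃ p q : C[X], t = aeval x p + y * aeval y q)
    (φ : T →ₐ[C] L) (hx : φ x = LaurentPolynomial.T 1)
    (hy : φ y = LaurentPolynomial.C b * LaurentPolynomial.T (-1)) : Function.Injective φ := by
  rw [injective_iff_map_eq_zero]
  intro t ht
  obtain ⟨p, q, rfl⟩ := NF t
  have hp : φ (aeval x p) = toLaurent p := by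
    rw [← aeval_algHom_apply, hx, ← Polynomial.toLaurentAlg_apply]
    have : (aeval (LaurentPolynomial.T 1 : L)) = (toLaurentAlg : C[X] →ₐ[C] L) := by
      ext : 1
      simp
    rw [this]
  have hq : φ (y * aeval y q) = (LaurentPolynomial.C b * LaurentPolynomial.T (-1) : L) *
      aeval (LaurentPolynomial.C b * LaurentPolynomial.T (-1) : L) q := by
    rw [map_mul, ← aeval_algHom_apply, hy]
  rw [map_add, hp, hq] at ht
  have hp0 : p = 0 := by
    have := congrArg LaurentPolynomial.trunc ht
    rwa [map_add, node_trunc, Polynomial.trunc_toLaurent, add_zero, map_zero] at this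
  subst hp0
  rw [map_zero, zero_add] at ht
  have hq0 : q = 0 := by
    have h1 := congrArg LaurentPolynomial.invert ht
    rw [map_zero, map_mul, ← aeval_algHom_apply, map_mul, LaurentPolynomial.invert_T] at h1
    have h2 : (LaurentPolynomial.invert (LaurentPolynomial.C b) *
      LaurentPolynomial.T (- -1) : L) = toLaurent (Polynomial.C b * X) := by
      simp
    rw [h2] at h1
    have h3 : aeval (toLaurent (Polynomial.C b * X) : L) q = toLaurent (q.comp (Polynomial.C b * X)) := by
      rw [← toLaurentAlg_apply, ← toLaurentAlg_apply, aeval_algHom_apply]; rfl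
    rw [h3, ← map_mul, toLaurent_eq_zero] at h1
    rcases mul_eq_zero.1 h1 with h | h
    · simp [hb] at h
    · rcases Polynomial.comp_eq_zero_iff.1 h with h | ⟨_, h⟩
      · exact h
      · have := congrArg (fun r => coeff r 1) h
        simp [hb] at this
  subst hq0
  simp

theorem node_denom [IsDomain C] [IsIntegrallyClosed C] {T : Type*} [CommRing T] [IsDomain T]
    [Algebra C T] (x : T) (φ : T →ₐ[C] L) (hφ : Function.Injective φ)
    (hx : φ x = LaurentPolynomial.T 1) (f : FractionRing T) (hf : IsIntegral T f) :
    ∃ (m : ℕ) (P : T), algebraMap T (FractionRing T) x ^ m * f = algebraMap T _ P := by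
  haveI : IsDomain L := IsLocalization.isDomain_of_le_nonZeroDivisors (R := C[X]) (M := Submonoid.powers (X : C[X])) _
    (powers_le_nonZeroDivisors_of_noZeroDivisors X_ne_zero)
  haveI : IsIntegrallyClosed L := isIntegrallyClosed_of_isLocalization (R := C[X])
    (M := Submonoid.powers (X : C[X])) (S := L)
    (powers_le_nonZeroDivisors_of_noZeroDivisors X_ne_zero)
  let K := FractionRing L
  let g : T →+* K := (algebraMap L K).comp φ.toRingHom
  have hg : Function.Injective g := (IsFractionRing.injective L K).comp hφ
  let ψ : FractionRing T →+* K := IsFractionRing.lift hg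
  have hψ : ∀ t, ψ (algebraMap T _ t) = algebraMap L K (φ t) := fun t =>
    IsFractionRing.lift_algebraMap hg t
  have hInteg : IsIntegral L (ψ f) := by
    obtain ⟨q, hq, hq0⟩ := hf
    refine ⟨q.map φ.toRingHom, hq.map _, ?_⟩
    rw [eval₂_map]
    have := Polynomial.hom_eval₂ q (algebraMap T (FractionRing T)) ψ f
    rw [hq0, map_zero] at this
    rw [this]
    congr 1
    ext t
    exact (hψ t).symm
  obtain ⟨ℓ, hℓ⟩ := (IsIntegrallyClosed.isIntegral_iff (R := L) (K := K)).1 hInteg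
  obtain ⟨m, p, hp⟩ := LaurentPolynomial.exists_T_pow ℓ
  refine ⟨m, aeval x p, ψ.injective ?_⟩
  rw [map_mul, map_pow, hψ, hψ, ← hℓ, hx, ← map_pow, ← map_mul]
  congr 1
  rw [← aeval_algHom_apply, hx, LaurentPolynomial.T_pow, mul_comm, mul_one, ← hp,
    ← Polynomial.toLaurentAlg_apply]
  have : (aeval (LaurentPolynomial.T 1 : L)) = (toLaurentAlg : C[X] →ₐ[C] L) := by
    ext : 1
    simp
  rw [this]

theorem node_div {T : Type*} [CommRing T] [IsDomain T] (x y : T) (hx0 : x ≠ 0)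
    (hxy : ∀ P, x ∣ y * P → x ∣ P) (m n : ℕ) (P : T) (h : x ^ m ∣ y ^ n * P) : x ^ m ∣ P := by
  have h1 : ∀ n P, x ∣ y ^ n * P → x ∣ P := by
    intro n
    induction n with
    | zero => intro P h; simpa using h
    | succ n ih => intro P h; exact ih _ (hxy _ (by rwa [← mul_assoc, ← pow_succ']))
  induction m generalizing P with
  | zero => simp
  | succ m ih =>
    obtain ⟨P', rfl⟩ := h1 n P ((dvd_pow_self x (Nat.succ_ne_zero m)).trans h)
    rw [pow_succ']
    refine mul_dvd_mul_left x (ih P' ?_)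
    rw [pow_succ', mul_left_comm] at h
    exact (mul_dvd_mul_iff_left hx0).1 h

/-- the ring `C[x][y]/(xy-b)`. -/
abbrev nodeRing (b : C) := AdjoinRoot (Polynomial.C (X : C[X]) * X - Polynomial.C (Polynomial.C b))

variable (b : C)
noncomputable def nodeX : nodeRing b := AdjoinRoot.of _ X
noncomputable def nodeY : nodeRing b := AdjoinRoot.root _

theorem node_mul : nodeX b * nodeY b = algebraMap C _ b := by
  have := AdjoinRoot.eval₂_root (Polynomial.C (X : C[X]) * X - Polynomial.C (Polynomial.C b))
  rw [eval₂_sub, eval₂_mul, eval₂_C, eval₂_X, eval₂_C, sub_eq_zero] at this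
  exact this

noncomputable def nodeLift {S : Type*} [CommRing S] (g : C →+* S) (x y : S) (h : x * y = g b) : nodeRing b →+* S :=
  AdjoinRoot.lift (eval₂RingHom g x) y (by simp [h])

theorem nodeLift_X {S : Type*} [CommRing S] (g : C →+* S) (x y : S) (h : x * y = g b) :
    nodeLift b g x y h (nodeX b) = x := by
  simp [nodeLift, nodeX]
theorem nodeLift_Y {S : Type*} [CommRing S] (g : C →+* S) (x y : S) (h : x * y = g b) :
    nodeLift b g x y h (nodeY b) = y := by
  simp [nodeLift, nodeY]
theorem nodeLift_C {S : Type*} [CommRing S] (g : C →+* S) (x y : S) (h : x * y = g b) (c : C) :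
    nodeLift b g x y h (algebraMap C _ c) = g c := by
  have : algebraMap C (nodeRing b) c = AdjoinRoot.of _ (Polynomial.C c) := rfl
  rw [this]
  simp [nodeLift]

theorem NF_mulx {T : Type*} [CommRing T] [Algebra C T] {x y : T} (hxy : x * y = algebraMap C T b)
    (p q : C[X]) : ∃ p' q' : C[X], x * (aeval x p + y * aeval y q) = aeval x p' + y * aeval y q' := by
  refine ⟨X * p + Polynomial.C (b * q.coeff 0), Polynomial.C b * q.divX, ?_⟩
  have := congrArg (aeval y) (Polynomial.X_mul_divX_add q)
  rw [← this]
  simp only [map_add, map_mul, aeval_X, aeval_C]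
  linear_combination (y * aeval y q.divX + algebraMap C T (q.coeff 0)) * hxy

theorem NF_swap {T : Type*} [CommRing T] [Algebra C T] {x y : T}
    (p q : C[X]) : ∃ p' q' : C[X], (aeval x p + y * aeval y q) = aeval y p' + x * aeval x q' := by
  refine ⟨X * q + Polynomial.C (p.coeff 0), p.divX, ?_⟩
  have := congrArg (aeval x) (Polynomial.X_mul_divX_add p)
  rw [← this]
  simp only [map_add, map_mul, aeval_X, aeval_C]
  ring

theorem node_NF (t : nodeRing b) : ∃ p q : C[X], t = aeval (nodeX b) p + nodeY b * aeval (nodeY b) q := by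
  obtain ⟨t, rfl⟩ := AdjoinRoot.mk_surjective t
  induction t using Polynomial.induction_on with
  | C a =>
    refine ⟨a, 0, ?_⟩
    rw [AdjoinRoot.mk_C, map_zero, mul_zero, add_zero]
    induction a using Polynomial.induction_on' with
    | add p q hp hq => simp only [map_add, hp, hq]
    | monomial n c =>
      rw [aeval_monomial, ← C_mul_X_pow_eq_monomial, map_mul, map_pow]
      rfl
  | add f g hf hg =>
    obtain ⟨p, q, h⟩ := hf
    obtain ⟨p', q', h'⟩ := hg
    exact ⟨p + p', q + q', by simp only [map_add, h, h']; ring⟩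
  | monomial n a h =>
    obtain ⟨p, q, h⟩ := h
    have e : AdjoinRoot.mk (Polynomial.C (X : C[X]) * X - Polynomial.C (Polynomial.C b)) (Polynomial.C a * X ^ (n + 1)) =
      nodeY b * AdjoinRoot.mk _ (Polynomial.C a * X ^ n) := by
      rw [pow_succ, ← mul_assoc, map_mul, AdjoinRoot.mk_X]; exact mul_comm _ _
    rw [e, h]
    obtain ⟨p1, q1, h1⟩ := NF_swap (x := nodeX b) (y := nodeY b) p q
    obtain ⟨p2, q2, h2⟩ := NF_mulx b (x := nodeY b) (y := nodeX b) (by rw [mul_comm]; exact node_mul b) p1 q1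
    obtain ⟨p3, q3, h3⟩ := NF_swap (x := nodeY b) (y := nodeX b) p2 q2
    exact ⟨p3, q3, by rw [h1, h2, h3]⟩

theorem node_quot (P : nodeRing b) (h : nodeX b ∣ nodeY b * P) : nodeX b ∣ P := by
  let g : C →+* (C ⧸ Ideal.span {b})[X] := Polynomial.C.comp (Ideal.Quotient.mk _)
  have hg : g b = 0 := by
    simp [g, Ideal.Quotient.eq_zero_iff_mem.2 (Ideal.mem_span_singleton_self b)]
  let ρ := nodeLift b g 0 X (by rw [hg, zero_mul])
  have hρ : ρ P = 0 := by
    obtain ⟨Q, hQ⟩ := h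
    have := congrArg ρ hQ
    rw [map_mul, map_mul, nodeLift_X, nodeLift_Y, zero_mul] at this
    apply (Polynomial.monic_X.mem_nonZeroDivisors).1 _ this
  obtain ⟨p, q, rfl⟩ := node_NF b P
  have hp : ∀ r : C[X], ρ (aeval (nodeY b) r) = r.map (Ideal.Quotient.mk (Ideal.span {b})) := by
    intro r
    rw [aeval_def, hom_eval₂]
    have : ρ (nodeY b) = X := nodeLift_Y _ _ _ _ _
    rw [this, Polynomial.map]
    congr 1
    ext1 c
    exact nodeLift_C b g 0 X (by rw [hg, zero_mul]) c
  have hdvd : ∀ r : C[X], r.map (Ideal.Quotient.mk (Ideal.span {b})) = 0 → nodeX b ∣ aeval (nodeY b) r := by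
    intro r hr
    have : Polynomial.C b ∣ r := by
      rw [C_dvd_iff_dvd_coeff]
      intro i
      rw [← Ideal.mem_span_singleton, ← Ideal.Quotient.eq_zero_iff_mem, ← coeff_map, hr, coeff_zero]
    obtain ⟨s, rfl⟩ := this
    rw [map_mul, aeval_C, ← node_mul]
    exact ⟨nodeY b * aeval (nodeY b) s, by ring⟩
  obtain ⟨p', q', h'⟩ := NF_swap (x := nodeX b) (y := nodeY b) p q
  rw [h'] at hρ ⊢
  have hX0 : ρ (nodeX b) = 0 := nodeLift_X _ _ _ _ _
  rw [map_add, map_mul, hX0, zero_mul, add_zero, hp] at hρ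
  exact dvd_add (hdvd _ hρ) (dvd_mul_right _ _)

noncomputable def nodeLaurentX : nodeRing b →ₐ[C] L where
  __ := nodeLift b (algebraMap C L) (LaurentPolynomial.T 1)
    (LaurentPolynomial.C b * LaurentPolynomial.T (-1)) (by
      rw [← LaurentPolynomial.C_eq_algebraMap, mul_left_comm, ← LaurentPolynomial.T_add]; simp)
  commutes' c := nodeLift_C _ _ _ _ _ _

noncomputable def nodeLaurentY : nodeRing b →ₐ[C] L where
  __ := nodeLift b (algebraMap C L) 
    (LaurentPolynomial.C b * LaurentPolynomial.T (-1)) (LaurentPolynomial.T 1) (by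
      rw [← LaurentPolynomial.C_eq_algebraMap, mul_assoc, ← LaurentPolynomial.T_add]; simp)
  commutes' c := nodeLift_C _ _ _ _ _ _

theorem nodeLaurentX_X : nodeLaurentX b (nodeX b) = LaurentPolynomial.T 1 :=
  nodeLift_X b (algebraMap C L) _ _ (by
      rw [← LaurentPolynomial.C_eq_algebraMap, mul_left_comm, ← LaurentPolynomial.T_add]; simp)
theorem nodeLaurentX_Y : nodeLaurentX b (nodeY b) = LaurentPolynomial.C b * LaurentPolynomial.T (-1) :=
  nodeLift_Y b (algebraMap C L) _ _ (by
      rw [← LaurentPolynomial.C_eq_algebraMap, mul_left_comm, ← LaurentPolynomial.T_add]; simp)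
theorem nodeLaurentY_Y : nodeLaurentY b (nodeY b) = LaurentPolynomial.T 1 :=
  nodeLift_Y b (algebraMap C L) _ _ (by
      rw [← LaurentPolynomial.C_eq_algebraMap, mul_assoc, ← LaurentPolynomial.T_add]; simp)
theorem nodeLaurentY_X : nodeLaurentY b (nodeX b) = LaurentPolynomial.C b * LaurentPolynomial.T (-1) :=
  nodeLift_X b (algebraMap C L) _ _ (by
      rw [← LaurentPolynomial.C_eq_algebraMap, mul_assoc, ← LaurentPolynomial.T_add]; simp)

theorem node_injX [IsDomain C] (hb : b ≠ 0) : Function.Injective (nodeLaurentX b) :=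
  node_inj hb (nodeX b) (nodeY b) (node_NF b) _ (nodeLaurentX_X b) (nodeLaurentX_Y b)

theorem node_injY [IsDomain C] (hb : b ≠ 0) : Function.Injective (nodeLaurentY b) :=
  node_inj hb (nodeY b) (nodeX b) (fun t => by
    obtain ⟨p, q, h⟩ := node_NF b t
    obtain ⟨p', q', h'⟩ := NF_swap (x := nodeX b) (y := nodeY b) p q
    exact ⟨p', q', by rw [h, h']⟩) _ (nodeLaurentY_Y b) (nodeLaurentY_X b)

theorem node_isDomain [IsDomain C] (hb : b ≠ 0) : IsDomain (nodeRing b) := by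
  haveI : IsDomain L := IsLocalization.isDomain_of_le_nonZeroDivisors (R := C[X]) (M := Submonoid.powers (X : C[X])) _
    (powers_le_nonZeroDivisors_of_noZeroDivisors X_ne_zero)
  exact (node_injX b hb).isDomain (nodeLaurentX b).toRingHom

theorem node_ne_zero [IsDomain C] (hb : b ≠ 0) : nodeX b ≠ 0 ∧ nodeY b ≠ 0 := by
  have h : algebraMap C (nodeRing b) b ≠ 0 := by
    intro h
    have := congrArg (nodeLift b (RingHom.id C) 1 b (by simp)) h
    rw [nodeLift_C, map_zero] at this
    exact hb this
  rw [← node_mul] at h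
  exact ⟨left_ne_zero_of_mul h, right_ne_zero_of_mul h⟩

theorem node_isIntegrallyClosed [IsDomain C] [IsIntegrallyClosed C] (hb : b ≠ 0) :
    IsIntegrallyClosed (nodeRing b) := by
  haveI := node_isDomain b hb
  rw [isIntegrallyClosed_iff (FractionRing (nodeRing b))]
  intro f hf
  obtain ⟨m, P, hP⟩ := node_denom (nodeX b) (nodeLaurentX b) (node_injX b hb) (nodeLaurentX_X b) f hf
  obtain ⟨n, Q, hQ⟩ := node_denom (nodeY b) (nodeLaurentY b) (node_injY b hb) (nodeLaurentY_Y b) f hf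
  have h1 : nodeY b ^ n * P = nodeX b ^ m * Q := by
    apply IsFractionRing.injective (nodeRing b) (FractionRing (nodeRing b))
    rw [map_mul, map_mul, ← hP, ← hQ, map_pow, map_pow]; ring
  obtain ⟨R, rfl⟩ := node_div (nodeX b) (nodeY b) (node_ne_zero b hb).1 (node_quot b) m n P ⟨Q, h1⟩
  refine ⟨R, ?_⟩
  rw [map_mul, map_pow] at hP
  have : algebraMap (nodeRing b) (FractionRing (nodeRing b)) (nodeX b) ≠ 0 :=
    (map_ne_zero_iff _ (IsFractionRing.injective _ _)).2 (node_ne_zero b hb).1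
  exact (mul_left_cancel₀ (pow_ne_zero m this) hP).symm

end node

universe v

/-- Normal models: a universal-test formulation. -/
theorem exists_normal_model (n : ℕ) : ∀ (C : Type u) [CommRing C] [IsDomain C] [IsIntegrallyClosed C]
    {Λ : Type v} [CommRing Λ] (g : C →+* Λ) (b : C) (p : Fin n → Prop) [DecidablePred p]
    (z : Fin n → Λ) (_ : (∏ i, if p i then z i else 1) = g b)
    (_ : (b ≠ 0 ∧ ∃ i, p i) ∨ (b = 1 ∧ ∀ i, ¬ p i) ∨ (b = 0 ∧ ∃ i, p i ∧ z i = 0)),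
    ∃ (N : Type u) (_ : CommRing N) (_ : IsDomain N) (_ : IsIntegrallyClosed N) (h : C →+* N)
      (x : Fin n → N) (ν : N →+* Λ), (∏ i, if p i then x i else 1) = h b ∧
        ν.comp h = g ∧ ∀ i, ν (x i) = z i := by
  induction n with
  | zero =>
    intro C _ _ _ Λ _ g b p _ z hz hc
    refine ⟨C, inferInstance, inferInstance, inferInstance, RingHom.id C, 0, g, ?_, by simp, fun i => i.elim0⟩
    rcases hc with ⟨_, i, _⟩ | ⟨rfl, _⟩ | ⟨_, i, _⟩
    · exact i.elim0
    · simp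
    · exact i.elim0
  | succ n ih =>
    intro C _ _ _ Λ _ g b p _ z hz hc
    -- step where the first variable is free
    have free : ∀ (p' : Fin n → Prop) [DecidablePred p'] (b' : C) 
        (_ : (∏ i : Fin n, if p' i then z i.succ else 1) = g b')
        (_ : (b' ≠ 0 ∧ ∃ i, p' i) ∨ (b' = 1 ∧ ∀ i, ¬ p' i) ∨ (b' = 0 ∧ ∃ i, p' i ∧ z i.succ = 0)),
        ∃ (N : Type u) (_ : CommRing N) (_ : IsDomain N) (_ : IsIntegrallyClosed N) (h : C →+* N)
        (x : Fin (n + 1) → N) (ν : N →+* Λ), (∏ i : Fin n, if p' i then x i.succ else 1) = h b' ∧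
        ν.comp h = g ∧ ∀ i, ν (x i) = z i := by
      intro p' _ b' h1 h2
      obtain ⟨N, _, _, _, h, x, ν, e1, e2, e3⟩ := ih C[X] (eval₂RingHom g (z 0)) (Polynomial.C b') p'
        (fun i => z i.succ) (by simpa using h1) (by
          rwa [Ne, Polynomial.C_eq_zero, ← Polynomial.C_1, Polynomial.C_inj])
      refine ⟨N, inferInstance, inferInstance, inferInstance, h.comp Polynomial.C, Fin.cons (h X) x, ν,
        ?_, ?_, ?_⟩
      · simpa using e1
      · rw [← RingHom.comp_assoc, e2]; ext c; simp
      · intro i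
        refine Fin.cases ?_ (fun i => ?_) i
        · have := congrArg (fun r => r X) e2
          simpa using this
        · simpa using e3 i
    rw [Fin.prod_univ_succ] at hz
    by_cases hp0 : p 0
    · rw [if_pos hp0] at hz
      rcases hc with ⟨hb, _⟩ | ⟨_, h⟩ | ⟨hb, h⟩
      · by_cases hex : ∃ i : Fin n, p i.succ
        · have d := node_isDomain b hb
          have d' := node_isIntegrallyClosed b hb
          obtain ⟨N, _, _, _, h, x, ν, e1, e2, e3⟩ := ih (nodeRing b)
            (nodeLift b g (z 0) _ hz) (nodeY b) (fun i => p i.succ)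
            (fun i => z i.succ) (nodeLift_Y _ _ _ _ _).symm (.inl ⟨(node_ne_zero b hb).2, hex⟩)
          refine ⟨N, inferInstance, inferInstance, inferInstance, h.comp (algebraMap C _), Fin.cons (h (nodeX b)) x, ν,
            ?_, ?_, ?_⟩
          · rw [Fin.prod_univ_succ, if_pos hp0]
            simp only [Fin.cons_zero, Fin.cons_succ]
            rw [e1, ← map_mul, node_mul]; rfl
          · rw [← RingHom.comp_assoc, e2]; ext c; exact nodeLift_C b g _ _ hz c
          · intro i
            refine Fin.cases ?_ (fun i => ?_) i
            · have := congrArg (fun r => r (nodeX b)) e2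
              simp only [RingHom.comp_apply, nodeLift_X] at this
              exact this
            · simpa using e3 i
        · push Not at hex
          obtain ⟨N, _, _, _, h, x, ν, e1, e2, e3⟩ := ih C g 1 (fun i => p i.succ)
            (fun i => z i.succ) (by simp [hex]) (.inr (.inl ⟨rfl, hex⟩))
          refine ⟨N, inferInstance, inferInstance, inferInstance, h, Fin.cons (h b) x, ν,
            ?_, e2, ?_⟩
          · rw [Fin.prod_univ_succ, if_pos hp0]
            simp only [Fin.cons_zero, Fin.cons_succ]
            rw [e1]; simp
          · intro i
            refine Fin.cases ?_ (fun i => ?_) i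
            · have := congrArg (fun r => r b) e2
              simp only [RingHom.comp_apply] at this
              rw [Fin.cons_zero, this, ← hz]; simp [hex]
            · simpa using e3 i
      · exact absurd hp0 (h 0)
      · subst hb
        by_cases hz0 : z 0 = 0
        · obtain ⟨N, _, _, _, h, x, ν, e1, e2, e3⟩ := ih C g 1 (fun i => False)
            (fun i => z i.succ) (by simp) (.inr (.inl ⟨rfl, by simp⟩))
          refine ⟨N, inferInstance, inferInstance, inferInstance, h, Fin.cons 0 x, ν,
            ?_, e2, ?_⟩
          · rw [Fin.prod_univ_succ, if_pos hp0]
            simp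
          · intro i
            refine Fin.cases ?_ (fun i => ?_) i
            · simp [hz0]
            · simpa using e3 i
        · obtain ⟨i, hpi, hzi⟩ := h
          obtain ⟨j, rfl⟩ : ∃ j : Fin n, i = j.succ := by
            refine Fin.cases (fun h => absurd h hz0) (fun j _ => ⟨j, rfl⟩) i hzi
          obtain ⟨N, i1, i2, i3, h, x, ν, e1, e2, e3⟩ := free (fun i => p i.succ) 0 (by
            rw [map_zero]; exact Finset.prod_eq_zero (Finset.mem_univ j) (by simp [hpi, hzi]))
            (.inr (.inr ⟨rfl, j, hpi, hzi⟩))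
          refine ⟨N, i1, i2, i3, h, x, ν, ?_, e2, e3⟩
          rw [Fin.prod_univ_succ, e1]; simp
    · rw [if_neg hp0, one_mul] at hz
      obtain ⟨N, i1, i2, i3, h, x, ν, e1, e2, e3⟩ := free (fun i => p i.succ) b hz (by
        have hs : ∀ q : Fin (n + 1) → Prop, ¬ q 0 → (∃ i, q i) → ∃ i : Fin n, q i.succ := by
          rintro q hq ⟨i, hi⟩
          revert hi
          refine Fin.cases (fun h => absurd h hq) (fun j h => ⟨j, h⟩) i
        rcases hc with ⟨hb, h⟩ | ⟨hb, h⟩ | ⟨hb, h⟩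
        · exact .inl ⟨hb, hs _ hp0 h⟩
        · exact .inr (.inl ⟨hb, fun i => h _⟩)
        · exact .inr (.inr ⟨hb, hs (fun i => p i ∧ z i = 0) (fun h => hp0 h.1) h⟩))
      refine ⟨N, i1, i2, i3, h, x, ν, ?_, e2, e3⟩
      rw [Fin.prod_univ_succ, e1]; simp [hp0]
end NeronSemistable

set_option linter.style.haveILetI false
namespace NeronSemistable
open TensorProduct

section D
variable {R : Type u} [CommRing R] {A : Type u} [CommRing A] [Algebra R A]
variable {Rc T B : Type u} [CommRing Rc] [CommRing T] [CommRing B] [Algebra R Rc] [Algebra R T]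
  [Algebra R B] [Algebra Rc T] [Algebra Rc B] [Algebra T B] [IsScalarTower R Rc T]
  [IsScalarTower R Rc B] [IsScalarTower Rc T B] [IsScalarTower R T B]

theorem chart_core [Algebra.Etale T B]
    (n l : ℕ) (b : Rc) (t : Fin n → T)
    (hT : ∀ (S : Type u) [CommRing S] (g : Rc →+* S) (z : Fin n → S),
      (∏ i : Fin n, if (i : ℕ) < l then z i else 1) = g b →
        ∃ h : T →+* S, h.comp (algebraMap Rc T) = g ∧ ∀ i, h (t i) = z i)
    (hTu : ∀ (S : Type u) [CommRing S] (h₁ h₂ : T →+* S),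
      h₁.comp (algebraMap Rc T) = h₂.comp (algebraMap Rc T) → (∀ i, h₁ (t i) = h₂ (t i)) → h₁ = h₂)
    (C : Type u) [CommRing C] [IsDomain C] [IsIntegrallyClosed C] (Λ : Type u) [CommRing Λ]
    (toM : A ⊗[R] B →+* Λ) (g : C →+* Λ) (aC : A →+* C) (rc : Rc →+* C)
    (hac : aC.comp (algebraMap R A) = rc.comp (algebraMap R Rc))
    (hga : g.comp aC = toM.comp Algebra.TensorProduct.includeLeftRingHom)
    (z : Fin n → Λ)
    (hzt : ∀ i, z i = toM (1 ⊗ₜ algebraMap T B (t i)))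
    (hrc : ∀ r, g (rc r) = toM (1 ⊗ₜ (algebraMap Rc B r)))
    (hz : (∏ i : Fin n, if (i : ℕ) < l then z i else 1) = g (rc b))
    (hcase : ((rc b ≠ 0 ∧ ∃ i : Fin n, (i : ℕ) < l) ∨ (rc b = 1 ∧ ∀ i : Fin n, ¬ (i : ℕ) < l) ∨
      (rc b = 0 ∧ ∃ i : Fin n, (i : ℕ) < l ∧ z i = 0)))
    (y₁ y₂ w : Ideal Λ) [y₁.IsPrime] [y₂.IsPrime] [w.IsPrime] (h₁ : y₁ ≤ w) (h₂ : y₂ ≤ w) :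
    ∃ y₀ : Ideal (A ⊗[R] B), y₀.IsPrime ∧ y₀ ≤ y₁.comap toM ∧ y₀ ≤ y₂.comap toM := by
  obtain ⟨N, _, _, _, h, x, ν, e1, e2, e3⟩ :=
    exists_normal_model n C g (rc b) (fun i => (i : ℕ) < l) z hz hcase
  obtain ⟨τ, τ1, τ2⟩ := hT N (h.comp rc) x e1
  letI : Algebra T N := τ.toAlgebra
  letI : Algebra R N := (h.comp (aC.comp (algebraMap R A))).toAlgebra
  haveI : IsScalarTower R T N := IsScalarTower.of_algebraMap_eq fun r => by
    change h (aC (algebraMap R A r)) = τ (algebraMap R T r)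
    rw [IsScalarTower.algebraMap_apply R Rc T]
    have := congrArg (fun f => f (algebraMap R Rc r)) τ1
    have h2 := congrArg (fun f => f r) hac
    simp only [RingHom.comp_apply] at this h2
    rw [this, h2]
  let aN : A →ₐ[R] N :=
    { h.comp aC with commutes' := fun r => rfl }
  let e : A ⊗[R] B →ₐ[R] N ⊗[T] B :=
    Algebra.TensorProduct.lift (S := R) ((IsScalarTower.toAlgHom R N (N ⊗[T] B)).comp aN)
      ((Algebra.TensorProduct.includeRight : B →ₐ[T] N ⊗[T] B).restrictScalars R) (fun _ _ => .all _ _)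
  letI : Algebra T Λ := (ν.comp τ).toAlgebra
  let νT : N →ₐ[T] Λ := { ν with commutes' := fun r => rfl }
  let iB : B →+* A ⊗[R] B := (Algebra.TensorProduct.includeRight : B →ₐ[R] A ⊗[R] B).toRingHom
  have hν : (toM.comp (iB.comp (algebraMap T B))) = ν.comp τ := by
    apply hTu
    · rw [RingHom.comp_assoc _ τ ν, τ1, ← RingHom.comp_assoc _ h ν, e2]
      ext r
      change toM (1 ⊗ₜ (algebraMap T B (algebraMap Rc T r))) = g (rc r)
      rw [hrc, IsScalarTower.algebraMap_apply Rc T B]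
    · intro i
      change toM (1 ⊗ₜ (algebraMap T B (t i))) = ν (τ (t i))
      rw [τ2, e3, hzt]
  let bT : B →ₐ[T] Λ := { toM.comp iB with
    commutes' := fun r => congrArg (fun f => f r) hν }
  let ρ : N ⊗[T] B →ₐ[T] Λ := Algebra.TensorProduct.lift νT bT (fun _ _ => .all _ _)
  have hρe : ρ.toRingHom.comp e.toRingHom = toM := by
    apply Algebra.TensorProduct.ringHom_ext
    · ext a
      change ρ (e (a ⊗ₜ 1)) = _
      have : e (a ⊗ₜ 1) = aN a ⊗ₜ 1 := by simp [e]
      rw [this]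
      have h3 : ρ (aN a ⊗ₜ 1) = ν (aN a) := by
        simp [ρ, νT]
      rw [h3]
      have h4 := congrArg (fun f => f (aC a)) e2
      have h5 := congrArg (fun f => f a) hga
      simp only [RingHom.comp_apply] at h4 h5
      exact h4.trans h5
    · ext β
      change ρ (e (1 ⊗ₜ β)) = toM (iB β)
      have : e (1 ⊗ₜ β) = 1 ⊗ₜ β := by simp [e]
      rw [this]
      have h3 : ρ (1 ⊗ₜ β) = bT β := by
        simp [ρ]
      rw [h3]; rfl
  let p₁ : Ideal (N ⊗[T] B) := y₁.comap ρ.toRingHom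
  let p₂ : Ideal (N ⊗[T] B) := y₂.comap ρ.toRingHom
  let P : Ideal (N ⊗[T] B) := w.comap ρ.toRingHom
  haveI : p₁.IsPrime := Ideal.comap_isPrime _ _
  haveI : p₂.IsPrime := Ideal.comap_isPrime _ _
  haveI : P.IsPrime := Ideal.comap_isPrime _ _
  obtain ⟨P₀, hP₀, hmin⟩ := etale_exists_min_prime (A := N) P
  have i₁ := hmin p₁ inferInstance (Ideal.comap_mono h₁)
  have i₂ := hmin p₂ inferInstance (Ideal.comap_mono h₂)
  refine ⟨P₀.comap e.toRingHom, Ideal.comap_isPrime _ _, ?_, ?_⟩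
  · rw [← hρe, ← Ideal.comap_comap]
    exact Ideal.comap_mono i₁
  · rw [← hρe, ← Ideal.comap_comap]
    exact Ideal.comap_mono i₂

/-- Local ring data. -/
theorem exists_local_data {S : Type u} [CommRing S] {C' : Type u} [CommRing C'] (c : C' →+* S)
    (y₁ y₂ w : Ideal S) [y₁.IsPrime] [y₂.IsPrime] [hw : w.IsPrime] (h₁ : y₁ ≤ w) (h₂ : y₂ ≤ w)
    (q : Ideal C') [q.IsPrime] (hq : q = w.comap c) :
    ∃ (Λ : Type u) (_ : CommRing Λ) (toM : S →+* Λ) (g : Localization.AtPrime q →+* Λ)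
      (Y₁ Y₂ W : Ideal Λ), Y₁.IsPrime ∧ Y₂.IsPrime ∧ W.IsPrime ∧ Y₁ ≤ W ∧ Y₂ ≤ W ∧
      Y₁.comap toM = y₁ ∧ Y₂.comap toM = y₂ ∧ (∀ x ∈ y₁, x ∈ y₂ → toM x = 0) ∧
      g.comp (algebraMap C' _) = toM.comp c := by
  let Q := S ⧸ (y₁ ⊓ y₂)
  let π : S →+* Q := Ideal.Quotient.mk _
  have key : ∀ Y : Ideal S, Y.IsPrime → y₁ ⊓ y₂ ≤ Y →
      (Y.map π).IsPrime ∧ (Y.map π).comap π = Y := by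
    intro Y hY hle
    refine ⟨Ideal.map_isPrime_of_surjective Ideal.Quotient.mk_surjective (by rwa [Ideal.mk_ker]), ?_⟩
    rw [Ideal.comap_map_of_surjective' _ Ideal.Quotient.mk_surjective, Ideal.mk_ker, sup_eq_left]
    exact hle
  obtain ⟨p1, c1⟩ := key y₁ ‹_› inf_le_left
  obtain ⟨p2, c2⟩ := key y₂ ‹_› inf_le_right
  obtain ⟨p3, c3⟩ := key w ‹_› (inf_le_left.trans h₁)
  let w' := w.map π
  let M := Localization.AtPrime w'
  have d₁ : Disjoint (w'.primeCompl : Set Q) (y₁.map π) :=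
    Set.disjoint_left.2 fun x hx hx' => hx (Ideal.map_mono h₁ hx')
  have d₂ : Disjoint (w'.primeCompl : Set Q) (y₂.map π) :=
    Set.disjoint_left.2 fun x hx hx' => hx (Ideal.map_mono h₂ hx')
  have P1 := IsLocalization.isPrime_of_isPrime_disjoint w'.primeCompl M _ p1 d₁
  have P2 := IsLocalization.isPrime_of_isPrime_disjoint w'.primeCompl M _ p2 d₂
  refine ⟨M, inferInstance, (algebraMap Q M).comp π,
    Localization.localRingHom q w' (π.comp c) (by rw [hq, ← Ideal.comap_comap, c3]),
    (y₁.map π).map (algebraMap Q M), (y₂.map π).map (algebraMap Q M), IsLocalRing.maximalIdeal M,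
    P1, P2, inferInstance, IsLocalRing.le_maximalIdeal P1.ne_top,
    IsLocalRing.le_maximalIdeal P2.ne_top, ?_, ?_, ?_, ?_⟩
  · rw [← Ideal.comap_comap]
    refine Eq.trans ?_ c1
    congr 1
    exact IsLocalization.under_map_of_isPrime_disjoint w'.primeCompl M p1 d₁
  · rw [← Ideal.comap_comap]
    refine Eq.trans ?_ c2
    congr 1
    exact IsLocalization.under_map_of_isPrime_disjoint w'.primeCompl M p2 d₂
  · intro x hx hx'
    change algebraMap Q M (π x) = 0
    rw [show π x = 0 from Ideal.Quotient.eq_zero_iff_mem.2 (Ideal.mem_inf.2 ⟨hx, hx'⟩), map_zero]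
  · ext x
    exact Localization.localRingHom_to_map q w' (π.comp c) (by rw [hq, ← Ideal.comap_comap, c3]) x

theorem chart_min_prime [IsDomain A] [IsIntegrallyClosed A] [Algebra.Etale R Rc] [Algebra.Etale T B]
    (n l : ℕ) (b : Rc) (t : Fin n → T)
    (ht : (∏ i : Fin n, if (i : ℕ) < l then t i else 1) = algebraMap Rc T b)
    (hT : ∀ (S : Type u) [CommRing S] (g : Rc →+* S) (z : Fin n → S),
      (∏ i : Fin n, if (i : ℕ) < l then z i else 1) = g b →
        ∃ h : T →+* S, h.comp (algebraMap Rc T) = g ∧ ∀ i, h (t i) = z i)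
    (hTu : ∀ (S : Type u) [CommRing S] (h₁ h₂ : T →+* S),
      h₁.comp (algebraMap Rc T) = h₂.comp (algebraMap Rc T) → (∀ i, h₁ (t i) = h₂ (t i)) → h₁ = h₂)
    (y₁ y₂ w : Ideal (A ⊗[R] B)) [y₁.IsPrime] [y₂.IsPrime] [w.IsPrime] (h₁ : y₁ ≤ w) (h₂ : y₂ ≤ w)
    (hA : y₁.comap (Algebra.TensorProduct.includeLeftRingHom : A →+* A ⊗[R] B) = ⊥)
    (hB : ∀ β : B, (1 : A) ⊗ₜ[R] β ∈ y₁ → (1 : A) ⊗ₜ[R] β ∈ y₂) :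
    ∃ y₀ : Ideal (A ⊗[R] B), y₀.IsPrime ∧ y₀ ≤ y₁ ∧ y₀ ≤ y₂ := by
  let c : A ⊗[R] Rc →+* A ⊗[R] B :=
    (Algebra.TensorProduct.map (AlgHom.id A A) (IsScalarTower.toAlgHom R Rc B)).toRingHom
  have hcA : ∀ a, c (algebraMap A _ a) = algebraMap A _ a := fun a => AlgHom.commutes _ a
  have hcR : ∀ r, c (1 ⊗ₜ r) = 1 ⊗ₜ (algebraMap Rc B r) := fun r => by
    change (Algebra.TensorProduct.map (AlgHom.id A A) (IsScalarTower.toAlgHom R Rc B)) (1 ⊗ₜ r) = _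
    simp
  obtain ⟨q, hq⟩ : ∃ q, q = w.comap c := ⟨_, rfl⟩
  haveI : q.IsPrime := by rw [hq]; exact Ideal.comap_isPrime _ _
  haveI : IsDomain (Localization.AtPrime q) := etale_isDomain_localization (A := A) q
  haveI : IsIntegrallyClosed (Localization.AtPrime q) :=
    etale_isIntegrallyClosed_localization (A := A) q
  obtain ⟨Λ, _, toM, g, Y₁, Y₂, W, P1, P2, P3, l1, l2, c1, c2, hz0, hg⟩ :=
    exists_local_data c y₁ y₂ w h₁ h₂ q hq
  have hg' : ∀ x, g (algebraMap _ _ x) = toM (c x) := fun x => congrArg (fun f => f x) hg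
  let iC := algebraMap (A ⊗[R] Rc) (Localization.AtPrime q)
  let rc : Rc →+* Localization.AtPrime q :=
    iC.comp (Algebra.TensorProduct.includeRight : Rc →ₐ[R] A ⊗[R] Rc).toRingHom
  let aC : A →+* Localization.AtPrime q :=
    iC.comp Algebra.TensorProduct.includeLeftRingHom
  have hrc : ∀ r, g (rc r) = toM (1 ⊗ₜ (algebraMap Rc B r)) := by
    intro r
    rw [← hcR, ← hg']; rfl
  let z : Fin n → Λ := fun i => toM (1 ⊗ₜ (algebraMap T B (t i)))
  have hprod : (1 : A) ⊗ₜ[R] (algebraMap Rc B b) =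
      ∏ i : Fin n, if (i : ℕ) < l then (1 : A) ⊗ₜ[R] (algebraMap T B (t i)) else 1 := by
    rw [IsScalarTower.algebraMap_apply Rc T B, ← ht, map_prod]
    change (Algebra.TensorProduct.includeRight : B →ₐ[R] A ⊗[R] B) _ = _
    rw [map_prod]
    refine Finset.prod_congr rfl fun i _ => ?_
    split_ifs <;> simp [Algebra.TensorProduct.one_def]
  have hz : (∏ i : Fin n, if (i : ℕ) < l then z i else 1) = g (rc b) := by
    rw [hrc, hprod, map_prod]
    refine Finset.prod_congr rfl fun i _ => ?_
    split_ifs <;> simp [z]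
  have hcase : ((rc b ≠ 0 ∧ ∃ i : Fin n, (i : ℕ) < l) ∨ (rc b = 1 ∧ ∀ i : Fin n, ¬ (i : ℕ) < l) ∨
      (rc b = 0 ∧ ∃ i : Fin n, (i : ℕ) < l ∧ z i = 0)) := by
    by_cases hex : ∃ i : Fin n, (i : ℕ) < l
    · by_cases hb : rc b = 0
      · refine .inr (.inr ⟨hb, ?_⟩)
        have h1 : (1 : A) ⊗ₜ[R] (algebraMap Rc B b) ∈ y₁ := by
          have h2 := hrc b
          rw [hb, map_zero] at h2
          rw [← c1, Ideal.mem_comap, ← h2]; exact zero_mem _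
        rw [hprod, Ideal.IsPrime.prod_mem_iff] at h1
        obtain ⟨i, _, hi⟩ := h1
        split_ifs at hi with hil
        · exact ⟨i, hil, hz0 _ hi (hB _ hi)⟩
        · exact absurd ((Ideal.eq_top_iff_one _).2 hi) Ideal.IsPrime.ne_top'
      · exact .inl ⟨hb, hex⟩
    · push Not at hex
      refine .inr (.inl ⟨?_, fun i => not_lt.2 (hex i)⟩)
      haveI : (y₁.comap c).IsPrime := Ideal.comap_isPrime _ _
      have := etale_eq_zero_of_mem (A := A) q (y₁.comap c) (hq ▸ Ideal.comap_mono h₁) (by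
        rw [← hA, Ideal.comap_comap]
        congr 1
        ext a
        exact hcA a) (1 ⊗ₜ b - 1) (by
          have : (1 : A) ⊗ₜ[R] (algebraMap Rc B b) = 1 := by
            rw [hprod]; exact Finset.prod_eq_one fun i _ => if_neg (not_lt.2 (hex i))
          rw [Ideal.mem_comap, map_sub, map_one, hcR, this, sub_self]; exact zero_mem _)
      rw [map_sub, map_one, sub_eq_zero] at this
      exact this
  obtain ⟨y₀, hy, k1, k2⟩ := chart_core (A := A) n l b t hT hTu (Localization.AtPrime q) Λ toM g aC rc
    (by
      ext r
      change iC _ = iC _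
      congr 1
      change (algebraMap R A r) ⊗ₜ[R] (1 : Rc) = (1 : A) ⊗ₜ algebraMap R Rc r
      rw [Algebra.algebraMap_eq_smul_one, Algebra.algebraMap_eq_smul_one, TensorProduct.smul_tmul])
    (by
      ext a
      change g (algebraMap (A ⊗[R] Rc) (Localization.AtPrime q) (algebraMap A (A ⊗[R] Rc) a)) = toM _
      rw [hg', hcA]; rfl) z (fun i => rfl) hrc hz hcase Y₁ Y₂ W l1 l2
  exact ⟨y₀, hy, c1 ▸ k1, c2 ▸ k2⟩

end D
end NeronSemistable

set_option linter.style.haveILetI false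
namespace NeronSemistable
open TensorProduct

section D2

theorem going_up {B S : Type*} [CommRing B] [CommRing S] (f : B →+* S) (hf : f.IsIntegral)
    (Q : Ideal B) [Q.IsPrime] (I : Ideal S) (h : I.comap f ≤ Q) :
    ∃ J : Ideal S, I ≤ J ∧ J.IsPrime ∧ J.comap f = Q := by
  letI := f.toAlgebra
  haveI : Algebra.IsIntegral B S := ⟨hf⟩
  exact Ideal.exists_ideal_over_prime_of_isIntegral Q I h

theorem incomparable {B S : Type*} [CommRing B] [CommRing S] (f : B →+* S) (hf : f.IsIntegral)
    (I J : Ideal S) [I.IsPrime] (hIJ : I ≤ J) (h : I.comap f = J.comap f) : I = J := by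
  letI := f.toAlgebra
  haveI : Algebra.IsIntegral B S := ⟨hf⟩
  by_contra hne
  exact (Ideal.IsIntegral.comap_lt_comap (R := B) (lt_of_le_of_ne hIJ hne)).ne h

theorem includeRight_isIntegral {R A B : Type*} [CommRing R] [CommRing A] [CommRing B] [Algebra R A]
    [Algebra R B] [Algebra.IsIntegral R A] :
    (Algebra.TensorProduct.includeRight : B →ₐ[R] A ⊗[R] B).toRingHom.IsIntegral := by
  have h : (algebraMap B (B ⊗[R] A)).IsIntegral := fun x => Algebra.IsIntegral.isIntegral x
  have h2 := h.trans _ (Algebra.TensorProduct.comm R B A).toRingEquiv.toRingHom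
    (RingHom.isIntegral_of_surjective _ (Algebra.TensorProduct.comm R B A).surjective)
  have e : (Algebra.TensorProduct.includeRight : B →ₐ[R] A ⊗[R] B).toRingHom =
      (Algebra.TensorProduct.comm R B A).toRingEquiv.toRingHom.comp (algebraMap B (B ⊗[R] A)) := by
    ext x
    change 1 ⊗ₜ x = Algebra.TensorProduct.comm R B A (x ⊗ₜ 1)
    simp
  rw [e]
  exact h2

theorem prime_over_closed_unique {R A B : Type u} [CommRing R] [CommRing A] [CommRing B]
    [Algebra R A] [Algebra R B] [IsLocalRing R] [IsSepClosed (IsLocalRing.ResidueField R)]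
    [IsLocalRing A] [Algebra.IsIntegral R A] [IsLocalHom (algebraMap R A)]
    (w₁ w₂ : Ideal (A ⊗[R] B)) [w₁.IsPrime] [w₂.IsPrime]
    (hA₁ : w₁.comap (Algebra.TensorProduct.includeLeftRingHom : A →+* A ⊗[R] B) = IsLocalRing.maximalIdeal A)
    (hA₂ : w₂.comap (Algebra.TensorProduct.includeLeftRingHom : A →+* A ⊗[R] B) = IsLocalRing.maximalIdeal A)
    (hB : w₁.comap (Algebra.TensorProduct.includeRight : B →ₐ[R] A ⊗[R] B).toRingHom =
      w₂.comap (Algebra.TensorProduct.includeRight : B →ₐ[R] A ⊗[R] B).toRingHom) : w₁ = w₂ := by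
  let κ := IsLocalRing.ResidueField R
  let κA := IsLocalRing.ResidueField A
  haveI : Algebra.IsAlgebraic κ κA := by
    haveI : Algebra.IsIntegral R κA := Algebra.IsIntegral.trans A
    haveI : Algebra.IsIntegral κ κA := Algebra.IsIntegral.tower_top R
    infer_instance
  haveI : IsPurelyInseparable κ κA := inferInstance
  let φ : A →ₐ[R] κA := IsScalarTower.toAlgHom R A κA
  let σ : A ⊗[R] B →ₐ[R] κA ⊗[R] B :=
    Algebra.TensorProduct.map φ (AlgHom.id R B)
  have hσs : Function.Surjective σ :=
    TensorProduct.map_surjective IsLocalRing.residue_surjective Function.surjective_id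
  have hσk : RingHom.ker σ.toRingHom ≤ w₁ ∧ RingHom.ker σ.toRingHom ≤ w₂ := by
    have : RingHom.ker σ.toRingHom = (IsLocalRing.maximalIdeal A).map
      (Algebra.TensorProduct.includeLeftRingHom : A →+* A ⊗[R] B) := by
      have := Algebra.TensorProduct.rTensor_ker (R := R) (S := R) (A := A) (B := κA) (C := B) φ
        IsLocalRing.residue_surjective
      have e : RingHom.ker φ = IsLocalRing.maximalIdeal A :=
        IsLocalRing.ker_residue
      rw [e] at this
      exact this
    rw [this]
    exact ⟨Ideal.map_le_iff_le_comap.2 hA₁.ge, Ideal.map_le_iff_le_comap.2 hA₂.ge⟩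
  have hsp := _root_.range_comap_of_surjective _ σ.toRingHom hσs
  obtain ⟨v₁, hv₁⟩ : (⟨w₁, inferInstance⟩ : PrimeSpectrum (A ⊗[R] B)) ∈ Set.range (PrimeSpectrum.comap σ.toRingHom) := by
    rw [hsp]; exact hσk.1
  obtain ⟨v₂, hv₂⟩ : (⟨w₂, inferInstance⟩ : PrimeSpectrum (A ⊗[R] B)) ∈ Set.range (PrimeSpectrum.comap σ.toRingHom) := by
    rw [hsp]; exact hσk.2
  suffices h : v₁ = v₂ by
    rw [h, hv₂] at hv₁
    exact (congrArg PrimeSpectrum.asIdeal hv₁).symm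
  have hinj := (PrimeSpectrum.isHomeomorph_comap_tensorProductMap_of_isPurelyInseparable
    (R := R) (S := B) (K := κ) κA).injective
  apply hinj
  have hs : Function.Surjective (Algebra.TensorProduct.includeRight : B →ₐ[R] κ ⊗[R] B).toRingHom := by
    intro x
    induction x using TensorProduct.induction_on with
    | zero => exact ⟨0, map_zero _⟩
    | add x y hx hy =>
      obtain ⟨a, rfl⟩ := hx
      obtain ⟨c, rfl⟩ := hy
      exact ⟨a + c, map_add _ _ _⟩
    | tmul x y =>
      obtain ⟨r, rfl⟩ := IsLocalRing.residue_surjective x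
      refine ⟨r • y, ?_⟩
      change 1 ⊗ₜ[R] (r • y) = _
      rw [← TensorProduct.smul_tmul, ← Algebra.algebraMap_eq_smul_one]; rfl
  apply PrimeSpectrum.comap_injective_of_surjective _ hs
  have hcomp : ∀ v : PrimeSpectrum (κA ⊗[R] B), 
    PrimeSpectrum.comap (Algebra.TensorProduct.includeRight : B →ₐ[R] κ ⊗[R] B).toRingHom
      (PrimeSpectrum.comap (Algebra.TensorProduct.map (Algebra.ofId κ κA) (.id R B)).toRingHom v) =
    PrimeSpectrum.comap (Algebra.TensorProduct.includeRight : B →ₐ[R] A ⊗[R] B).toRingHom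
      (PrimeSpectrum.comap σ.toRingHom v) := by
    intro v
    rw [← PrimeSpectrum.comap_comp_apply, ← PrimeSpectrum.comap_comp_apply]
    refine congrArg (fun f => PrimeSpectrum.comap f v) ?_
    ext β
    change Algebra.TensorProduct.map (Algebra.ofId κ κA) (.id R B) (1 ⊗ₜ β) = σ (1 ⊗ₜ β)
    simp [σ]
  rw [hcomp, hcomp, hv₁, hv₂]
  ext1
  exact hB

end D2
end NeronSemistable

set_option linter.style.haveILetI false
namespace NeronSemistable
open TensorProduct

section D3
variable {R : Type u} [CommRing R] [HenselianLocalRing R] [IsSepClosed (IsLocalRing.ResidueField R)]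
variable {Rc T B : Type u} [CommRing Rc] [CommRing T] [CommRing B] [Algebra R Rc] [Algebra R T]
  [Algebra R B] [Algebra Rc T] [Algebra Rc B] [Algebra T B] [IsScalarTower R Rc T]
  [IsScalarTower R Rc B] [IsScalarTower Rc T B] [IsScalarTower R T B]

theorem hat_prime_unique {A : Type u} [CommRing A] [Algebra R A] [IsDomain A] [IsIntegrallyClosed A]
    [Algebra.IsIntegral R A] [Algebra.Etale R Rc] [Algebra.Etale T B]
    (n l : ℕ) (b : Rc) (t : Fin n → T)
    (ht : (∏ i : Fin n, if (i : ℕ) < l then t i else 1) = algebraMap Rc T b)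
    (hT : ∀ (S : Type u) [CommRing S] (g : Rc →+* S) (z : Fin n → S),
      (∏ i : Fin n, if (i : ℕ) < l then z i else 1) = g b →
        ∃ h : T →+* S, h.comp (algebraMap Rc T) = g ∧ ∀ i, h (t i) = z i)
    (hTu : ∀ (S : Type u) [CommRing S] (h₁ h₂ : T →+* S),
      h₁.comp (algebraMap Rc T) = h₂.comp (algebraMap Rc T) → (∀ i, h₁ (t i) = h₂ (t i)) → h₁ = h₂)
    (Qy Qu : Ideal B) [Qu.IsPrime] (hle : Qy ≤ Qu)
    (hQu : Qu.comap (algebraMap R B) = IsLocalRing.maximalIdeal R)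
    (hmin : ∀ Q : Ideal B, Q.IsPrime → Q ≤ Qy → Q.comap (algebraMap R B) = RingHom.ker (algebraMap R A) → Q = Qy)
    (y₁ y₂ : Ideal (A ⊗[R] B)) [y₁.IsPrime] [y₂.IsPrime]
    (hA₁ : y₁.comap (Algebra.TensorProduct.includeLeftRingHom : A →+* A ⊗[R] B) = ⊥)
    (hA₂ : y₂.comap (Algebra.TensorProduct.includeLeftRingHom : A →+* A ⊗[R] B) = ⊥)
    (hB₁ : y₁.comap (Algebra.TensorProduct.includeRight : B →ₐ[R] A ⊗[R] B).toRingHom = Qy)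
    (hB₂ : y₂.comap (Algebra.TensorProduct.includeRight : B →ₐ[R] A ⊗[R] B).toRingHom = Qy) :
    y₁ = y₂ := by
  haveI : IsLocalRing A := isLocalRing_of_integral R
  haveI : IsLocalHom (algebraMap R A) := ⟨fun r hr => by
    by_contra h
    have hm : (IsLocalRing.maximalIdeal A).comap (algebraMap R A) = IsLocalRing.maximalIdeal R :=
      IsLocalRing.eq_maximalIdeal (Ideal.isMaximal_comap_of_isIntegral_of_isMaximal _)
    have h2 : r ∈ IsLocalRing.maximalIdeal R := (IsLocalRing.mem_maximalIdeal r).2 h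
    rw [← hm] at h2
    exact (IsLocalRing.mem_maximalIdeal _).1 h2 hr⟩
  have hInteg := includeRight_isIntegral (R := R) (A := A) (B := B)
  obtain ⟨w₁, l₁, p₁, c₁⟩ := going_up _ hInteg Qu y₁ (hB₁.trans_le hle)
  obtain ⟨w₂, l₂, p₂, c₂⟩ := going_up _ hInteg Qu y₂ (hB₂.trans_le hle)
  have hcomm : (Algebra.TensorProduct.includeLeftRingHom : A →+* A ⊗[R] B).comp (algebraMap R A) =
      ((Algebra.TensorProduct.includeRight : B →ₐ[R] A ⊗[R] B).toRingHom).comp (algebraMap R B) := by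
    ext r
    change (algebraMap R A r) ⊗ₜ[R] (1 : B) = (1 : A) ⊗ₜ algebraMap R B r
    rw [Algebra.algebraMap_eq_smul_one, Algebra.algebraMap_eq_smul_one, TensorProduct.smul_tmul]
  have hmax : ∀ w : Ideal (A ⊗[R] B), w.IsPrime →
      w.comap (Algebra.TensorProduct.includeRight : B →ₐ[R] A ⊗[R] B).toRingHom = Qu →
      w.comap (Algebra.TensorProduct.includeLeftRingHom : A →+* A ⊗[R] B) = IsLocalRing.maximalIdeal A := by
    intro w hw hc
    apply IsLocalRing.eq_maximalIdeal
    haveI : (w.comap (Algebra.TensorProduct.includeLeftRingHom : A →+* A ⊗[R] B)).IsPrime :=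
      Ideal.comap_isPrime _ _
    apply Ideal.isMaximal_of_isIntegral_of_isMaximal_comap (R := R)
    rw [Ideal.comap_comap, hcomm, ← Ideal.comap_comap, hc, hQu]
    infer_instance
  obtain rfl : w₁ = w₂ := prime_over_closed_unique w₁ w₂ (hmax _ p₁ c₁) (hmax _ p₂ c₂) (c₁.trans c₂.symm)
  obtain ⟨y₀, p₀, k₁, k₂⟩ := chart_min_prime n l b t ht hT hTu y₁ y₂ w₁ l₁ l₂ hA₁ (fun β h => by
    have : β ∈ y₂.comap (Algebra.TensorProduct.includeRight : B →ₐ[R] A ⊗[R] B).toRingHom := by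
      rw [hB₂, ← hB₁]; exact h
    exact this)
  have h0 : y₀.comap (Algebra.TensorProduct.includeRight : B →ₐ[R] A ⊗[R] B).toRingHom = Qy := by
    apply hmin _ (Ideal.comap_isPrime _ _)
    · rw [← hB₁]; exact Ideal.comap_mono k₁
    · rw [Ideal.comap_comap, ← hcomm, ← Ideal.comap_comap, RingHom.ker_eq_comap_bot]
      congr 1
      exact le_bot_iff.1 (hA₁ ▸ Ideal.comap_mono k₁)
  exact (incomparable _ hInteg y₀ y₁ k₁ (h0.trans hB₁.symm)).symm.trans
    (incomparable _ hInteg y₀ y₂ k₂ (h0.trans hB₂.symm))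

theorem exists_integral_mult {R k Ω : Type*} [CommRing R] [Field k] [Field Ω] [Algebra R k] [Algebra k Ω]
    [Algebra R Ω] [IsScalarTower R k Ω] [Algebra.IsAlgebraic k Ω]
    (hk : ∀ x : k, ∃ a s : R, algebraMap R k s ≠ 0 ∧ x * algebraMap R k s = algebraMap R k a) (ω : Ω) :
    ∃ s : R, algebraMap R k s ≠ 0 ∧ IsIntegral R (ω * algebraMap R Ω s) := by
  let A₀ := (algebraMap R k).range
  haveI : IsFractionRing A₀ k := IsFractionRing.of_field _ _ (fun z => by
    obtain ⟨a, s, hs, h⟩ := hk z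
    refine ⟨⟨_, a, rfl⟩, ⟨_, s, rfl⟩, ?_⟩
    rw [eq_div_iff]
    · exact h
    · exact hs)
  haveI : Algebra.IsAlgebraic A₀ Ω := (IsFractionRing.comap_isAlgebraic_iff (A := A₀) (K := k)).2 inferInstance
  obtain ⟨⟨_, s, rfl⟩, hy, hi⟩ := (Algebra.IsAlgebraic.isAlgebraic (R := A₀) ω).exists_integral_multiple
  refine ⟨s, fun h => hy (Subtype.ext h), ?_⟩
  letI : Algebra R A₀ := (algebraMap R k).rangeRestrict.toAlgebra
  haveI : IsScalarTower R A₀ Ω := IsScalarTower.of_algebraMap_eq fun r => by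
    rw [IsScalarTower.algebraMap_apply R k Ω]; rfl
  haveI : Algebra.IsIntegral R A₀ := 
    ⟨(algebraMap R k).rangeRestrict.isIntegral_of_surjective (algebraMap R k).rangeRestrict_surjective⟩
  have := isIntegral_trans (R := R) _ hi
  rw [Algebra.smul_def] at this
  rw [mul_comm, IsScalarTower.algebraMap_apply R k Ω]
  exact this

theorem tensor_subsingleton {k Ω F : Type u} [Field k] [Field Ω] [Field F] [Algebra R k] [Algebra R Ω]
    [Algebra R F] [Algebra B F] [Algebra k F] [Algebra k Ω] [IsScalarTower R k Ω] [IsScalarTower R k F]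
    [IsScalarTower R B F] [Algebra.IsAlgebraic k Ω] [IsAlgClosed Ω]
    [Algebra.Etale R Rc] [Algebra.Etale T B]
    (hk : ∀ x : k, ∃ a s : R, algebraMap R k s ≠ 0 ∧ x * algebraMap R k s = algebraMap R k a)
    (hF : ∀ x : F, ∃ a s : B, algebraMap B F s ≠ 0 ∧ x * algebraMap B F s = algebraMap B F a)
    (n l : ℕ) (b : Rc) (t : Fin n → T)
    (ht : (∏ i : Fin n, if (i : ℕ) < l then t i else 1) = algebraMap Rc T b)
    (hT : ∀ (S : Type u) [CommRing S] (g : Rc →+* S) (z : Fin n → S),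
      (∏ i : Fin n, if (i : ℕ) < l then z i else 1) = g b →
        ∃ h : T →+* S, h.comp (algebraMap Rc T) = g ∧ ∀ i, h (t i) = z i)
    (hTu : ∀ (S : Type u) [CommRing S] (h₁ h₂ : T →+* S),
      h₁.comp (algebraMap Rc T) = h₂.comp (algebraMap Rc T) → (∀ i, h₁ (t i) = h₂ (t i)) → h₁ = h₂)
    (Qu : Ideal B) [Qu.IsPrime] (hle : RingHom.ker (algebraMap B F) ≤ Qu)
    (hQu : Qu.comap (algebraMap R B) = IsLocalRing.maximalIdeal R)
    (hmin : ∀ Q : Ideal B, Q.IsPrime → Q ≤ RingHom.ker (algebraMap B F) →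
      Q.comap (algebraMap R B) = RingHom.ker (algebraMap R k) → Q = RingHom.ker (algebraMap B F))
    (P₁ P₂ : Ideal (Ω ⊗[k] F)) [P₁.IsPrime] [P₂.IsPrime] : P₁ = P₂ := by
  let A := integralClosure R Ω
  haveI : IsIntegrallyClosed A := by
    rw [isIntegrallyClosed_iff (FractionRing A)]
    intro x hx
    let i : FractionRing A →ₐ[A] Ω := IsFractionRing.liftAlgHom (g := Algebra.ofId A Ω)
      (fun a b h => Subtype.ext h)
    have h1 : IsIntegral A (i x) := hx.map i
    have h2 : IsIntegral R (i x) := isIntegral_trans (R := R) _ h1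
    refine ⟨⟨i x, h2⟩, i.toRingHom.injective ?_⟩
    exact i.commutes _
  haveI : Algebra.IsIntegral R A := inferInstance
  let φ : A ⊗[R] B →ₐ[R] Ω ⊗[k] F :=
    Algebra.TensorProduct.lift (S := R)
      (((Algebra.TensorProduct.includeLeft : Ω →ₐ[k] Ω ⊗[k] F).restrictScalars R).comp A.val)
      (((Algebra.TensorProduct.includeRight : F →ₐ[k] Ω ⊗[k] F).restrictScalars R).comp
        (IsScalarTower.toAlgHom R B F)) (fun _ _ => .all _ _)
  have hφ : ∀ a β, φ (a ⊗ₜ β) = (a : Ω) ⊗ₜ algebraMap B F β := by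
    intro a β
    simp [φ]
  have hfield : ∀ (L : Type u) [Field L] (f : L →+* Ω ⊗[k] F) (P : Ideal (Ω ⊗[k] F)), P.IsPrime →
      P.comap f = ⊥ := by
    intro L _ f P hP
    exact (Ideal.eq_bot_of_prime (h := Ideal.comap_isPrime f P) _)
  have hA : ∀ P : Ideal (Ω ⊗[k] F), P.IsPrime → (P.comap φ.toRingHom).comap
      (Algebra.TensorProduct.includeLeftRingHom : A →+* A ⊗[R] B) = ⊥ := by
    intro P hP
    rw [eq_bot_iff]
    intro a ha
    have h1 : φ (a ⊗ₜ 1) ∈ P := ha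
    rw [hφ, map_one] at h1
    have h2 : (a : Ω) ∈ P.comap (Algebra.TensorProduct.includeLeftRingHom : Ω →+* Ω ⊗[k] F) := h1
    rw [hfield Ω _ P hP] at h2
    exact Subtype.ext h2
  have hB : ∀ P : Ideal (Ω ⊗[k] F), P.IsPrime → (P.comap φ.toRingHom).comap
      (Algebra.TensorProduct.includeRight : B →ₐ[R] A ⊗[R] B).toRingHom = RingHom.ker (algebraMap B F) := by
    intro P hP
    ext β
    change φ (1 ⊗ₜ β) ∈ P ↔ _
    rw [hφ]
    change algebraMap B F β ∈ P.comap (Algebra.TensorProduct.includeRight : F →ₐ[k] Ω ⊗[k] F).toRingHom ↔ _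
    rw [hfield F _ P hP]
    rfl
  haveI : (P₁.comap φ.toRingHom).IsPrime := Ideal.comap_isPrime _ _
  haveI : (P₂.comap φ.toRingHom).IsPrime := Ideal.comap_isPrime _ _
  have hkA : RingHom.ker (algebraMap R A) = RingHom.ker (algebraMap R k) := by
    ext r
    rw [RingHom.mem_ker, RingHom.mem_ker, ← map_eq_zero_iff (algebraMap k Ω) (algebraMap k Ω).injective,
      ← IsScalarTower.algebraMap_apply, Subtype.ext_iff]
    rfl
  have key := hat_prime_unique (A := A) n l b t ht hT hTu (RingHom.ker (algebraMap B F)) Qu hle hQu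
    (by rwa [hkA]) (P₁.comap φ.toRingHom) (P₂.comap φ.toRingHom)
    (hA _ inferInstance) (hA _ inferInstance) (hB _ inferInstance) (hB _ inferInstance)
  have hden : ∀ x : Ω ⊗[k] F, ∃ u, IsUnit u ∧ ∃ s v, φ s = u ∧ φ v = x * u := by
    intro x
    induction x using TensorProduct.induction_on with
    | zero => exact ⟨1, isUnit_one, 1, 0, map_one _, by simp⟩
    | tmul ω f =>
      obtain ⟨s, hs, hi⟩ := exists_integral_mult (R := R) (k := k) hk ω
      obtain ⟨a, s', hs', h'⟩ := hF f
      have hsΩ : algebraMap R Ω s ≠ 0 := by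
        rw [IsScalarTower.algebraMap_apply R k Ω]
        exact (map_ne_zero _).2 hs
      refine ⟨algebraMap R Ω s ⊗ₜ algebraMap B F s', ?_, algebraMap R A s ⊗ₜ s',
        (⟨_, hi⟩ : A) ⊗ₜ a, ?_, ?_⟩
      · refine IsUnit.of_mul_eq_one ((algebraMap R Ω s)⁻¹ ⊗ₜ (algebraMap B F s')⁻¹) ?_
        rw [Algebra.TensorProduct.tmul_mul_tmul, mul_inv_cancel₀ hsΩ, mul_inv_cancel₀ hs']; rfl
      · rw [hφ]; rfl
      · rw [hφ, Algebra.TensorProduct.tmul_mul_tmul, h']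
    | add x y hx hy =>
      obtain ⟨u, hu, s, v, h1, h2⟩ := hx
      obtain ⟨u', hu', s', v', h1', h2'⟩ := hy
      refine ⟨u * u', hu.mul hu', s * s', v * s' + v' * s, by rw [map_mul, h1, h1'], ?_⟩
      rw [map_add, map_mul, map_mul, h1, h1', h2, h2']; ring
  have fin : ∀ P P' : Ideal (Ω ⊗[k] F), P.comap φ.toRingHom = P'.comap φ.toRingHom → P ≤ P' := by
    intro P P' h x hx
    obtain ⟨u, hu, s, v, h1, h2⟩ := hden x
    have : v ∈ P.comap φ.toRingHom := by
      change φ v ∈ P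
      rw [h2]; exact Ideal.mul_mem_right _ _ hx
    rw [h] at this
    change φ v ∈ P' at this
    rw [h2] at this
    exact (Ideal.mul_unit_mem_iff_mem P' hu).1 this
  exact le_antisymm (fin _ _ key) (fin _ _ key.symm)
end D3
end NeronSemistable

set_option linter.style.haveILetI false
namespace NeronSemistable
open TensorProduct

section PE

theorem exists_point {Ω A : Type*} [Field Ω] [IsAlgClosed Ω] [CommRing A] [IsDomain A] [Algebra Ω A]
    [Algebra.FiniteType Ω A] (a : A) (ha : a ≠ 0) : ∃ ρ : A →ₐ[Ω] Ω, ρ a ≠ 0 := by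
  haveI : IsJacobsonRing A := isJacobsonRing_of_finiteType (A := Ω)
  have hj : Ideal.jacobson (⊥ : Ideal A) = ⊥ :=
    IsJacobsonRing.out ‹_› (Ideal.isPrime_bot (α := A)).isRadical
  have h : a ∉ Ideal.jacobson (⊥ : Ideal A) := by rw [hj]; exact ha
  rw [Ideal.jacobson, Submodule.mem_sInf] at h
  push Not at h
  obtain ⟨m, ⟨-, hm⟩, ham⟩ := h
  haveI := hm
  letI := Ideal.Quotient.field m
  haveI : Module.Finite Ω (A ⧸ m) := finite_of_finite_type_of_isJacobsonRing Ω (A ⧸ m)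
  let e : Ω ≃ₐ[Ω] (A ⧸ m) := AlgEquiv.ofBijective (Algebra.ofId Ω (A ⧸ m))
    (IsAlgClosed.algebraMap_bijective_of_isIntegral (k := Ω) (K := A ⧸ m))
  refine ⟨e.symm.toAlgHom.comp (Ideal.Quotient.mkₐ Ω m), fun h => ham ?_⟩
  have h2 : e.symm (Ideal.Quotient.mk m a) = 0 := h
  rw [map_eq_zero_iff _ e.symm.injective] at h2
  exact Ideal.Quotient.eq_zero_iff_mem.1 h2

theorem noZeroDivisors_fg {Ω A C : Type*} [Field Ω] [IsAlgClosed Ω] [CommRing A] [IsDomain A] [Algebra Ω A]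
    [Algebra.FiniteType Ω A] [CommRing C] [IsDomain C] [Algebra Ω C] (x y : A ⊗[Ω] C) (h : x * y = 0) :
    x = 0 ∨ y = 0 := by
  by_contra! hxy
  obtain ⟨hx, hy⟩ := hxy
  let e := Module.Free.chooseBasis Ω C
  let β := Algebra.TensorProduct.basis A e
  have key : ∀ z : A ⊗[Ω] C, z ≠ 0 → ∃ a : A, a ≠ 0 ∧ ∀ ρ : A →ₐ[Ω] Ω, ρ a ≠ 0 →
      Algebra.TensorProduct.lift ((Algebra.ofId Ω C).comp ρ) (AlgHom.id Ω C) (fun _ _ => .all _ _) z ≠ 0 := by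
    intro z hz
    have : β.repr z ≠ 0 := by simpa using hz
    obtain ⟨i, hi⟩ := Finsupp.ne_iff.1 this
    refine ⟨β.repr z i, hi, fun ρ hρ h0 => hρ ?_⟩
    have hz2 : z = (β.repr z).sum fun i a => a ⊗ₜ e i := by
      conv_lhs => rw [← β.linearCombination_repr z, Finsupp.linearCombination_apply]
      apply Finsupp.sum_congr
      intro i _
      simp [β, TensorProduct.smul_tmul']
    have h3 : ∑ j ∈ (β.repr z).support, ρ (β.repr z j) • e j = 0 := by
      rw [hz2, Finsupp.sum, map_sum] at h0
      rw [← h0]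
      refine Finset.sum_congr rfl fun j _ => ?_
      simp [Algebra.ofId_apply, Algebra.smul_def]
    have h4 := linearIndependent_iff'.1 e.linearIndependent _ _ h3 i
    exact h4 (Finsupp.mem_support_iff.2 hi)
  obtain ⟨a, ha, ka⟩ := key x hx
  obtain ⟨b, hb, kb⟩ := key y hy
  obtain ⟨ρ, hρ⟩ := exists_point (Ω := Ω) (a * b) (mul_ne_zero ha hb)
  rw [map_mul] at hρ
  have := congrArg (Algebra.TensorProduct.lift ((Algebra.ofId Ω C).comp ρ) (AlgHom.id Ω C) (fun _ _ => .all _ _)) h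
  rw [map_mul, map_zero] at this
  exact mul_ne_zero (ka ρ (left_ne_zero_of_mul hρ)) (kb ρ (right_ne_zero_of_mul hρ)) this

theorem noZeroDivisors_tensor {Ω A C : Type*} [Field Ω] [IsAlgClosed Ω] [CommRing A] [IsDomain A] [Algebra Ω A]
    [CommRing C] [IsDomain C] [Algebra Ω C] (x y : C ⊗[Ω] A) (h : x * y = 0) :
    x = 0 ∨ y = 0 := by
  obtain ⟨D₁, f₁, h₁⟩ := exists_fg_and_mem_baseChange x
  obtain ⟨D₂, f₂, h₂⟩ := exists_fg_and_mem_baseChange y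
  let D := D₁ ⊔ D₂
  haveI : Algebra.FiniteType Ω D := (Subalgebra.fg_iff_finiteType D).1 (f₁.sup f₂)
  have h_inj : Function.Injective (Algebra.TensorProduct.map (AlgHom.id C C) D.val) :=
    Module.Flat.lTensor_preserves_injective_linearMap (M := C) D.val.toLinearMap Subtype.val_injective
  have lift : ∀ D' : Subalgebra Ω A, D' ≤ D → ∀ x : C ⊗[Ω] A, x ∈ Subalgebra.baseChange C D' →
      ∃ x' : C ⊗[Ω] D, Algebra.TensorProduct.map (AlgHom.id C C) D.val x' = x := by
    rintro D' hle x ⟨z, rfl⟩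
    refine ⟨Algebra.TensorProduct.map (AlgHom.id C C) (Subalgebra.inclusion hle) z, ?_⟩
    have := Algebra.TensorProduct.map_comp (AlgHom.id C C) (AlgHom.id C C) D.val (Subalgebra.inclusion hle)
    exact (DFunLike.congr_fun this z).symm
  obtain ⟨x', rfl⟩ := lift D₁ le_sup_left x h₁
  obtain ⟨y', rfl⟩ := lift D₂ le_sup_right y h₂
  rw [← map_mul, map_eq_zero_iff _ h_inj] at h
  have := noZeroDivisors_fg (Algebra.TensorProduct.comm Ω C D x') (Algebra.TensorProduct.comm Ω C D y')
    (by rw [← map_mul, h, map_zero])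
  simp only [map_eq_zero_iff _ (Algebra.TensorProduct.comm Ω C D).injective] at this
  rcases this with h | h
  · left; rw [h, map_zero]
  · right; rw [h, map_zero]

theorem irreducibleSpace_of_tensor {k Ω F K : Type*} [Field k] [Field Ω] [Field F] [Field K] [IsAlgClosed Ω]
    [Algebra k Ω] [Algebra k F] [Algebra k K] [Algebra Ω K] [IsScalarTower k Ω K]
    (hP : ∀ P₁ P₂ : Ideal (Ω ⊗[k] F), P₁.IsPrime → P₂.IsPrime → P₁ = P₂) :
    IrreducibleSpace (PrimeSpectrum (K ⊗[k] F)) := by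
  let N := nilradical (Ω ⊗[k] F)
  haveI : Nontrivial (Ω ⊗[k] F) := inferInstance
  haveI hN : N.IsPrime := by
    obtain ⟨m, hm⟩ := Ideal.exists_maximal (Ω ⊗[k] F)
    have : N = m := by
      apply le_antisymm
      · exact nilradical_le_prime m
      · change m ≤ nilradical _
        rw [nilradical_eq_sInf]
        exact le_sInf fun P hp => (hP m P hm.isPrime hp).le
    rw [this]; exact hm.isPrime
  let q := Ideal.Quotient.mkₐ Ω N
  let φ : K ⊗[Ω] (Ω ⊗[k] F) →ₐ[Ω] K ⊗[Ω] ((Ω ⊗[k] F) ⧸ N) := Algebra.TensorProduct.map (AlgHom.id Ω K) q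
  have hker : ∀ z, φ z = 0 → z ∈ nilradical (K ⊗[Ω] (Ω ⊗[k] F)) := by
    intro z hz
    have h1 := Algebra.TensorProduct.lTensor_ker (A := K) q (Ideal.Quotient.mkₐ_surjective Ω N)
    have h2 : z ∈ RingHom.ker φ := hz
    rw [h1] at h2
    refine (Ideal.map_le_iff_le_comap.2 ?_) h2
    intro w hw
    have hw' : w ∈ N := by
      rw [RingHom.mem_ker] at hw
      exact Ideal.Quotient.eq_zero_iff_mem.1 hw
    exact (mem_nilradical.2 ((mem_nilradical.1 hw').map _))
  let e := Algebra.TensorProduct.cancelBaseChange k Ω Ω K F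
  have hp : (nilradical (K ⊗[Ω] (Ω ⊗[k] F))).IsPrime := by
    haveI : Nontrivial (K ⊗[Ω] (Ω ⊗[k] F)) := inferInstance
    refine ⟨fun h => ?_, fun {x y} hxy => ?_⟩
    · have : (1 : K ⊗[Ω] (Ω ⊗[k] F)) ∈ nilradical _ := h ▸ Submodule.mem_top
      exact not_isNilpotent_one (mem_nilradical.1 this)
    · obtain ⟨n, hn⟩ := mem_nilradical.1 hxy
      have : φ (x ^ n) * φ (y ^ n) = 0 := by rw [← map_mul, ← mul_pow, hn, map_zero]
      rcases noZeroDivisors_tensor _ _ this with h | h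
      · exact Or.inl (mem_nilradical.2 (mem_nilradical.1 (hker _ h)).of_pow)
      · exact Or.inr (mem_nilradical.2 (mem_nilradical.1 (hker _ h)).of_pow)
  haveI := PrimeSpectrum.irreducibleSpace_iff_isPrime_nilradical.2 hp
  let h := PrimeSpectrum.homeomorphOfRingEquiv e.toRingEquiv
  rw [irreducibleSpace_def, Set.top_eq_univ, ← h.surjective.range_eq, ← Set.image_univ]
  exact (IrreducibleSpace.isIrreducible_univ _).image _ h.continuous.continuousOn
end PE
end NeronSemistable

set_option linter.style.haveILetI false
namespace NeronSemistable
open TensorProduct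

section PF1

theorem geomIrreducible_of_point {k : Type u} [Field k] {Z : Scheme.{u}} (g : Z ⟶ Spec (.of k))
    {F : Type u} [Field F] [Algebra k F] (j : Spec (.of F) ⟶ Z) (y : Z) (hj : Set.range j = {y})
    (hjg : j ≫ g = Spec.map (CommRingCat.ofHom (algebraMap k F)))
    (H : ∀ (K : Type u) [Field K] [IsAlgClosed K] [Algebra k K],
      IrreducibleSpace (PrimeSpectrum (K ⊗[k] F))) :
    GeomIrreducibleOver (.of k) g (closure {y}) := by
  intro K _ ψ
  let K' := AlgebraicClosure K
  letI : Algebra k K := ψ.hom.toAlgebra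
  letI : Algebra k K' := ((algebraMap K K').comp ψ.hom).toAlgebra
  have hirr := H K'
  have hopen : IsOpenMap (pullback.fst g (Spec.map ψ)) := (pullback.fst g (Spec.map ψ)).isOpenMap
  have h1 : (pullback.fst g (Spec.map ψ)).base ⁻¹' closure {y} =
      closure ((pullback.fst g (Spec.map ψ)).base ⁻¹' {y}) :=
    hopen.preimage_closure_eq_closure_preimage (pullback.fst g (Spec.map ψ)).continuous _
  rw [h1]
  apply IsIrreducible.closure
  have e2 : Spec.map (CommRingCat.ofHom (algebraMap k K')) ≫ 𝟙 _ =
      Spec.map (CommRingCat.ofHom (algebraMap K K')) ≫ Spec.map ψ := by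
    rw [Category.comp_id, ← Spec.map_comp]; rfl
  have e1 : Spec.map (CommRingCat.ofHom (algebraMap k F)) ≫ 𝟙 _ = j ≫ g := by
    rw [Category.comp_id, hjg]
  have hr := Scheme.Pullback.range_map (f := Spec.map (CommRingCat.ofHom (algebraMap k F)))
    (g := Spec.map (CommRingCat.ofHom (algebraMap k K'))) g (Spec.map ψ) j
    (Spec.map (CommRingCat.ofHom (algebraMap K K'))) (𝟙 _) e1 e2
  have hs : Set.range (Spec.map (CommRingCat.ofHom (algebraMap K K'))) = Set.univ := by
    haveI : Subsingleton (Spec (CommRingCat.of K)) := inferInstanceAs (Subsingleton (PrimeSpectrum K))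
    exact Set.range_eq_univ.2 (Function.surjective_to_subsingleton _)
  rw [hj, hs, Set.preimage_univ, Set.inter_univ] at hr
  change IsIrreducible ((pullback.fst g (Spec.map ψ)) ⁻¹' {y})
  rw [← hr, ← Set.image_univ]
  refine IsIrreducible.image ?_ _ (Scheme.Hom.continuous _).continuousOn
  let e := pullbackSpecIso k F K'
  have he : Set.range e.inv = Set.univ := Set.range_eq_univ.2 e.inv.surjective
  let h := PrimeSpectrum.homeomorphOfRingEquiv (Algebra.TensorProduct.comm k K' F).toRingEquiv
  have hirr2 : IsIrreducible (Set.univ : Set (PrimeSpectrum (F ⊗[k] K'))) := by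
    rw [← h.surjective.range_eq, ← Set.image_univ]
    exact (IrreducibleSpace.isIrreducible_univ _).image _ h.continuous.continuousOn
  rw [← he, ← Set.image_univ]
  exact IsIrreducible.image hirr2 _ (Scheme.Hom.continuous _).continuousOn
end PF1
end NeronSemistable

set_option linter.style.haveILetI false
namespace NeronSemistable
open TensorProduct

section PF2

theorem stdRing_rel (Rc : Type u) [CommRing Rc] (n l : ℕ) (b : Rc) :
    (∏ i : Fin n, if (i : ℕ) < l then stdCoord Rc n l b i else 1) = algebraMap Rc (stdRing Rc n l b) b := by
  have h : Ideal.Quotient.mk (Ideal.span {(∏ i : Fin n, if (i : ℕ) < l then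
      (MvPolynomial.X i : MvPolynomial (Fin n) Rc) else 1) - MvPolynomial.C b})
      ((∏ i : Fin n, if (i : ℕ) < l then (MvPolynomial.X i : MvPolynomial (Fin n) Rc) else 1) -
        MvPolynomial.C b) = 0 :=
    Ideal.Quotient.eq_zero_iff_mem.2 (Ideal.mem_span_singleton_self _)
  rw [map_sub, sub_eq_zero, map_prod] at h
  refine Eq.trans ?_ h
  refine Finset.prod_congr rfl fun i _ => ?_
  split_ifs
  · rfl
  · rw [map_one]

theorem stdRing_lift (Rc : Type u) [CommRing Rc] (n l : ℕ) (b : Rc) (S : Type u) [CommRing S]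
    (g : Rc →+* S) (z : Fin n → S) (hz : (∏ i : Fin n, if (i : ℕ) < l then z i else 1) = g b) :
    ∃ h : stdRing Rc n l b →+* S, h.comp (algebraMap Rc (stdRing Rc n l b)) = g ∧
      ∀ i, h (stdCoord Rc n l b i) = z i := by
  refine ⟨Ideal.Quotient.lift _ (MvPolynomial.eval₂Hom g z) ?_, ?_, ?_⟩
  · intro a ha
    rw [← RingHom.mem_ker]
    refine (Ideal.span_le.2 ?_) ha
    rw [Set.singleton_subset_iff, SetLike.mem_coe, RingHom.mem_ker, map_sub, map_prod, sub_eq_zero,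
      MvPolynomial.eval₂Hom_C, ← hz]
    refine Finset.prod_congr rfl fun i _ => ?_
    split_ifs
    · exact MvPolynomial.eval₂Hom_X' _ _ _
    · rw [map_one]
  · ext r
    exact MvPolynomial.eval₂Hom_C _ _ _
  · intro i
    exact MvPolynomial.eval₂Hom_X' _ _ _

theorem stdRing_ext (Rc : Type u) [CommRing Rc] (n l : ℕ) (b : Rc) (S : Type u) [CommRing S]
    (h₁ h₂ : stdRing Rc n l b →+* S)
    (hc : h₁.comp (algebraMap Rc (stdRing Rc n l b)) = h₂.comp (algebraMap Rc (stdRing Rc n l b)))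
    (hx : ∀ i, h₁ (stdCoord Rc n l b i) = h₂ (stdCoord Rc n l b i)) : h₁ = h₂ := by
  apply Ideal.Quotient.ringHom_ext
  apply MvPolynomial.ringHom_ext
  · intro r
    exact DFunLike.congr_fun hc r
  · exact hx

theorem residueField_frac {B : Type u} [CommRing B] (q : Ideal B) [q.IsPrime] (x : q.ResidueField) :
    ∃ a s : B, algebraMap B q.ResidueField s ≠ 0 ∧
      x * algebraMap B q.ResidueField s = algebraMap B q.ResidueField a := by
  obtain ⟨a, s, hs, rfl⟩ := IsFractionRing.div_surjective (A := B ⧸ q) x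
  obtain ⟨a, rfl⟩ := Ideal.Quotient.mk_surjective a
  obtain ⟨s, rfl⟩ := Ideal.Quotient.mk_surjective s
  have hs' : algebraMap B q.ResidueField s ≠ 0 := by
    rw [Ne, Ideal.algebraMap_residueField_eq_zero]
    intro h
    exact nonZeroDivisors.ne_zero hs (Ideal.Quotient.eq_zero_iff_mem.2 h)
  refine ⟨a, s, hs', ?_⟩
  rw [Ideal.algebraMap_quotient_residueField_mk, Ideal.algebraMap_quotient_residueField_mk,
    div_mul_cancel₀ _ hs']

theorem ring_irreducible {R Rc B k : Type u} [CommRing R] [HenselianLocalRing R]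
    [IsSepClosed (IsLocalRing.ResidueField R)] [CommRing Rc] [CommRing B] [Field k] [Algebra R Rc]
    (n l : ℕ) (b : Rc) [Algebra (stdRing Rc n l b) B] [Algebra Rc B] [Algebra R B]
    [IsScalarTower R Rc B] [IsScalarTower Rc (stdRing Rc n l b) B]
    [Algebra.Etale R Rc] [Algebra.Etale (stdRing Rc n l b) B] [Algebra R k]
    (hk : ∀ x : k, ∃ a s : R, algebraMap R k s ≠ 0 ∧ x * algebraMap R k s = algebraMap R k a)
    (q Qu : Ideal B) [q.IsPrime] [Qu.IsPrime] (hle : q ≤ Qu)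
    [Algebra k q.ResidueField] [IsScalarTower R k q.ResidueField]
    (hQu : Qu.comap (algebraMap R B) = IsLocalRing.maximalIdeal R)
    (hmin : ∀ Q : Ideal B, Q.IsPrime → Q ≤ q →
      Q.comap (algebraMap R B) = q.comap (algebraMap R B) → Q = q)
    (K : Type u) [Field K] [IsAlgClosed K] [Algebra k K] :
      IrreducibleSpace (PrimeSpectrum (K ⊗[k] q.ResidueField)) := by
  let Ω := AlgebraicClosure k
  let θ : Ω →ₐ[k] K := IsAlgClosed.lift
  letI : Algebra Ω K := θ.toRingHom.toAlgebra
  haveI : IsScalarTower k Ω K := IsScalarTower.of_algebraMap_eq fun r => (θ.commutes r).symm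
  haveI : IsScalarTower R (stdRing Rc n l b) B := by
    refine IsScalarTower.of_algebraMap_eq (R := R) (S := stdRing Rc n l b) (A := B) fun r => ?_
    rw [IsScalarTower.algebraMap_apply R Rc B, IsScalarTower.algebraMap_apply R Rc (stdRing Rc n l b),
      ← IsScalarTower.algebraMap_apply Rc (stdRing Rc n l b) B]
  have hqk : q = RingHom.ker (algebraMap B q.ResidueField) := (Ideal.ker_algebraMap_residueField q).symm
  apply irreducibleSpace_of_tensor (Ω := Ω)
  intro P₁ P₂ _ _
  refine tensor_subsingleton (R := R) (Rc := Rc) (T := stdRing Rc n l b) (B := B) hk (residueField_frac q)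
    n l b (stdCoord Rc n l b) (stdRing_rel Rc n l b) (stdRing_lift Rc n l b) (stdRing_ext Rc n l b) Qu
    (hqk ▸ hle) hQu ?_ P₁ P₂
  intro Q hQ hQq hQR
  rw [← hqk] at hQq ⊢
  refine hmin Q hQ hQq ?_
  rw [hQR]
  ext r
  rw [RingHom.mem_ker, Ideal.mem_comap, ← Ideal.algebraMap_residueField_eq_zero (I := q),
    ← map_eq_zero_iff (algebraMap k q.ResidueField) (algebraMap k q.ResidueField).injective,
    ← IsScalarTower.algebraMap_apply, ← IsScalarTower.algebraMap_apply]
end PF2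
end NeronSemistable

set_option linter.style.haveILetI false
namespace NeronSemistable
open TensorProduct

section PF3

theorem eq_of_specializes_of_etale {U X : Scheme.{u}} (g : U ⟶ X) [Etale g] (a c : U) (hac : a ⤳ c)
    (h : g a = g c) : a = c := by
  haveI : LocallyQuasiFinite g := ⟨fun {O} hU {V} hV e => by
    have h1 := Etale.etale_appLE (f := g) hU hV e
    letI : Algebra Γ(X, O) Γ(U, V) := (g.appLE O V e).hom.toAlgebra
    haveI : Algebra.Etale Γ(X, O) Γ(U, V) := h1
    exact (inferInstance : Algebra.QuasiFinite Γ(X, O) Γ(U, V))⟩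
  have hd := g.isDiscrete_preimage_singleton (g c)
  haveI := hd.to_subtype
  let a' : g ⁻¹' {g c} := ⟨a, h⟩
  let c' : g ⁻¹' {g c} := ⟨c, rfl⟩
  have : a' ⤳ c' := (Topology.IsInducing.subtypeVal.specializes_iff).1 hac
  exact congrArg Subtype.val this.eq

theorem chart_point (R : CommRingCat.{u}) (hsh : StrictlyHenselianLocal ↥R)
    {X : Scheme.{u}} (f : X ⟶ Spec R) (η : ↑(Spec R)) (p : X) (hp : f p = η)
    (hmin : ∀ z, z ⤳ p → f z = η → z = p) (x : X) (hpx : p ⤳ x)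
    (hx : f x = closedPt R hsh.toIsLocalRing) (C : ChartData f x) :
    ∃ (F : Type u) (_ : Field F) (_ : Algebra ((Spec R).residueField η) F) (i : Spec (.of F) ⟶ X),
      Set.range i = {p} ∧
      i ≫ f = Spec.map (CommRingCat.ofHom (algebraMap ((Spec R).residueField η) F)) ≫
        (Spec R).fromSpecResidueField η ∧
      ∀ (K : Type u) [Field K] [IsAlgClosed K] [Algebra ((Spec R).residueField η) K],
        IrreducibleSpace (PrimeSpectrum (K ⊗[(Spec R).residueField η] F)) := by
  haveI := hsh.henselian
  haveI : IsSepClosed (IsLocalRing.ResidueField R) := hsh.sepClosedResidue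
  haveI : Etale C.etS := C.etS_etale
  haveI : Etale C.gX := C.gX_etale
  haveI : Etale C.gT := C.gT_etale
  have h1 : C.gX C.x' = x := C.hx'
  obtain ⟨y', hy'x, hy'⟩ := (Flat.generalizingMap C.gX) (a := C.x') (b := p) (by rw [h1]; exact hpx)
  obtain ⟨W, hW, hxW, -⟩ := exists_isAffineOpen_mem_and_subset (U := ⊤) (x := C.x') trivial
  have hyW : y' ∈ W := hy'x.mem_open W.2 hxW
  let B := Γ(C.U, W)
  let i : Spec B ⟶ C.U := hW.fromSpec
  have hi : ∀ z ∈ W, ∃ z' : Spec B, i z' = z := by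
    intro z hz
    have : z ∈ Set.range i := by rw [hW.range_fromSpec]; exact hz
    exact this
  obtain ⟨qx, hqx⟩ := hi _ hxW
  obtain ⟨qy, hqy⟩ := hi _ hyW
  have hspec : qy ⤳ qx := by
    rw [← i.isOpenEmbedding.isInducing.specializes_iff]
    change i qy ⤳ i qx
    rw [hqx, hqy]; exact hy'x
  let T := stdRing C.R C.n C.l C.b
  obtain ⟨α, hα⟩ : ∃ α : R ⟶ C.R, Spec.map α = C.etS := ⟨_, Spec.map_preimage _⟩
  obtain ⟨β, hβ⟩ : ∃ β : CommRingCat.of T ⟶ B, Spec.map β = i ≫ C.gT := ⟨_, Spec.map_preimage _⟩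
  letI : Algebra R C.R := α.hom.toAlgebra
  letI : Algebra T B := β.hom.toAlgebra
  letI : Algebra C.R B := (β.hom.comp (algebraMap C.R T)).toAlgebra
  letI : Algebra R B := ((β.hom.comp (algebraMap C.R T)).comp α.hom).toAlgebra
  haveI : IsScalarTower R C.R B := IsScalarTower.of_algebraMap_eq fun r => rfl
  haveI : IsScalarTower C.R T B := IsScalarTower.of_algebraMap_eq (R := C.R) (S := T) (A := B) fun r => rfl
  haveI : Algebra.Etale R C.R := by
    have : Etale (Spec.map α) := by rw [hα]; infer_instance
    exact (HasRingHomProperty.Spec_iff (P := @Etale)).1 this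
  haveI : Algebra.Etale T B := by
    have : Etale (Spec.map β) := by rw [hβ]; exact Etale.etale_comp i C.gT
    exact (HasRingHomProperty.Spec_iff (P := @Etale)).1 this
  have hγ : Spec.map (CommRingCat.ofHom (algebraMap R B)) = i ≫ C.gX ≫ f := by
    rw [← C.comm, ← hα, ← Category.assoc, ← hβ]
    change _ = Spec.map β ≫ Spec.map (CommRingCat.ofHom (algebraMap C.R T)) ≫ Spec.map α
    rw [← Spec.map_comp, ← Spec.map_comp]
    rfl
  have hγ' : ∀ z : Spec B, Ideal.comap (algebraMap R B) z.asIdeal = (f (C.gX (i z))).asIdeal := by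
    intro z
    have : Spec.map (CommRingCat.ofHom (algebraMap R B)) z = f (C.gX (i z)) := by rw [hγ]; rfl
    rw [← this]; rfl
  have hqη : Ideal.comap (algebraMap R B) qy.asIdeal = η.asIdeal := by
    rw [hγ', hqy, hy', hp]
  haveI := η.isPrime
  haveI := qy.isPrime
  haveI := qx.isPrime
  let κ := η.asIdeal.ResidueField
  let F := qy.asIdeal.ResidueField
  let k := (Spec R).residueField η
  let e := Scheme.Spec.residueFieldIso R η
  letI : Algebra R k := (e.inv.hom.comp (algebraMap R κ)).toAlgebra
  have hRF : ∀ r : R, algebraMap R F r = 0 ↔ r ∈ η.asIdeal := by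
    intro r
    rw [IsScalarTower.algebraMap_apply R B F, Ideal.algebraMap_residueField_eq_zero, ← hqη, Ideal.mem_comap]
  let θ : κ →+* F := Ideal.ResidueField.lift η.asIdeal (algebraMap R F)
    (fun r hr => (hRF r).2 hr) (fun r hr => IsUnit.mk0 _ (fun h => hr ((hRF r).1 h)))
  have hθ : ∀ r, θ (algebraMap R κ r) = algebraMap R F r := fun r => Ideal.ResidueField.lift_algebraMap _ _ _ _ _
  letI : Algebra k F := (θ.comp e.hom.hom).toAlgebra
  have hei : ∀ z : κ, e.hom.hom (e.inv.hom z) = z := fun z => by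
    rw [← CommRingCat.comp_apply, e.inv_hom_id]; rfl
  have hie : ∀ z : k, e.inv.hom (e.hom.hom z) = z := fun z => by
    rw [← CommRingCat.comp_apply, e.hom_inv_id]; rfl
  haveI : IsScalarTower R k F := IsScalarTower.of_algebraMap_eq fun r => by
    change _ = θ (e.hom.hom (e.inv.hom (algebraMap R κ r)))
    rw [hei, hθ]
  have hk : ∀ x : k, ∃ a s : R, algebraMap R k s ≠ 0 ∧ x * algebraMap R k s = algebraMap R k a := by
    intro x
    obtain ⟨a, s, hs, h⟩ := residueField_frac η.asIdeal (e.hom.hom x)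
    refine ⟨a, s, ?_, ?_⟩
    · change e.inv.hom (algebraMap R κ s) ≠ 0
      intro h0
      apply hs
      rw [← hei (algebraMap R κ s), h0, map_zero]
    · change x * e.inv.hom (algebraMap R κ s) = e.inv.hom (algebraMap R κ a)
      rw [← h, map_mul, hie]
  refine ⟨F, inferInstance, inferInstance,
    Spec.map (CommRingCat.ofHom (algebraMap B F)) ≫ i ≫ C.gX, ?_, ?_, ?_⟩
  · have hpt : ∀ z : Spec (.of F), Spec.map (CommRingCat.ofHom (algebraMap B F)) z = qy := by
      intro z
      apply PrimeSpectrum.ext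
      change Ideal.comap (algebraMap B F) z.asIdeal = _
      haveI := z.isPrime
      have : z.asIdeal = ⊥ := Ideal.eq_bot_of_prime (K := F) z.asIdeal
      rw [this, ← RingHom.ker_eq_comap_bot, Ideal.ker_algebraMap_residueField]
    have hpt2 : ∀ z : Spec (.of F), (Spec.map (CommRingCat.ofHom (algebraMap B F)) ≫ i ≫ C.gX) z = p := by
      intro z
      change C.gX (i (Spec.map (CommRingCat.ofHom (algebraMap B F)) z)) = p
      rw [hpt, hqy, hy']
    apply Set.eq_singleton_iff_unique_mem.2
    refine ⟨⟨(⟨⊥, Ideal.isPrime_bot⟩ : PrimeSpectrum F), hpt2 _⟩, ?_⟩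
    rintro _ ⟨z, rfl⟩
    exact hpt2 z
  · rw [Category.assoc, Category.assoc, ← hγ, ← Scheme.Spec.map_residueFieldIso_inv_eq_fromSpecResidueField,
      ← Spec.map_comp, ← Spec.map_comp, ← Spec.map_comp]
    congr 1
    ext r
    change algebraMap B F (algebraMap R B r) = θ (e.hom.hom (e.inv.hom (algebraMap R κ r)))
    rw [hei, hθ, ← IsScalarTower.algebraMap_apply]
  · intro K _ _ _
    refine ring_irreducible (R := R) (Rc := C.R) (B := B) (k := k) C.n C.l C.b hk qy.asIdeal qx.asIdeal
      ((PrimeSpectrum.le_iff_specializes _ _).2 hspec) ?_ ?_ K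
    · rw [hγ', hqx]
      have h1 := C.hx'
      change C.gX C.x' = x at h1
      rw [h1, hx]; rfl
    · intro Q hQ hle hc
      let qz : Spec B := (⟨Q, hQ⟩ : PrimeSpectrum B)
      have hz : qz ⤳ qy := (PrimeSpectrum.le_iff_specializes qz qy).1 hle
      have hz1 : i qz ⤳ i qy := hz.map i.continuous
      have hz2 : C.gX (i qz) = p := by
        apply hmin
        · rw [← hy', ← hqy]; exact hz1.map C.gX.continuous
        · apply PrimeSpectrum.ext
          rw [← hγ', ← hqη]; exact hc
      have hz3 : i qz = i qy := eq_of_specializes_of_etale C.gX _ _ hz1 (by rw [hz2, hqy, hy'])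
      have : qz = qy := i.isOpenEmbedding.injective hz3
      exact congrArg PrimeSpectrum.asIdeal this
end PF3
end NeronSemistable

set_option linter.style.haveILetI false
noncomputable section
namespace NeronSemistable

/-- Lemma 3.3 of the paper. -/
theorem component_of_fibre_geometrically_irreducible
    (R : CommRingCat.{u}) (hNoeth : IsNoetherianRing ↥R)
    (hsh : StrictlyHenselianLocal ↥R)
    {X : Scheme.{u}} (f : X ⟶ Spec R) (hss : IsSemistable f)
    (η : ↑(Spec R)) (hgen : η ⤳ closedPt R hsh.toIsLocalRing)
    (Y : Set (fiberScheme f η)) (hY : Y ∈ irreducibleComponents ↑(fiberScheme f η)) :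
    GeomIrreducibleOver ((Spec R).residueField η) (fiberRes f η) Y := by
  obtain ⟨hprop, -, hch⟩ := hss
  have hYc : IsClosed Y := isClosed_of_mem_irreducibleComponents Y hY
  have hYi : IsIrreducible Y := hY.1
  obtain ⟨y, hy⟩ : ∃ y, closure {y} = Y := ⟨_, hYi.isGenericPoint_genericPoint hYc⟩
  have hemb : Topology.IsEmbedding (fiberι f η) := (f.fiberι η).isEmbedding
  have hrange : Set.range (fiberι f η) = f ⁻¹' {η} := f.range_fiberι η
  have hp : f (fiberι f η y) = η := by
    have : fiberι f η y ∈ f ⁻¹' {η} := hrange ▸ Set.mem_range_self y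
    exact this
  have hmin : ∀ z, z ⤳ fiberι f η y → f z = η → z = fiberι f η y := by
    intro z hz hfz
    have : z ∈ Set.range (fiberι f η) := by rw [hrange]; exact hfz
    obtain ⟨z, rfl⟩ := this
    have h1 : z ⤳ y := hemb.isInducing.specializes_iff.1 hz
    have h2 : closure {z} ≤ Y := hY.2 isIrreducible_singleton.closure (by
      rw [← hy]; exact h1.closure_subset)
    have h3 : y ⤳ z := by
      rw [specializes_iff_mem_closure, hy]
      exact h2 (subset_closure rfl)
    rw [(h1.antisymm h3).eq]
  obtain ⟨x, hx1, hx2⟩ : ∃ x ∈ closure {fiberι f η y}, f x = closedPt R hsh.toIsLocalRing := by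
    have hcl : IsClosed (f '' closure {fiberι f η y}) := f.isClosedMap _ isClosed_closure
    have : closedPt R hsh.toIsLocalRing ∈ f '' closure {fiberι f η y} :=
      hgen.mem_closed hcl ⟨_, subset_closure rfl, hp⟩
    exact this
  obtain ⟨C⟩ := hch x
  obtain ⟨F, _, _, i, hi1, hi2, hK⟩ := chart_point R hsh f η _ hp hmin x
    (specializes_iff_mem_closure.2 hx1) hx2 C
  let j : Spec (.of F) ⟶ fiberScheme f η := pullback.lift i _ hi2
  have hj1 : j ≫ fiberι f η = i := pullback.lift_fst _ _ _
  have hj2 : j ≫ fiberRes f η = _ := pullback.lift_snd _ _ hi2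
  have hjr : Set.range j = {y} := by
    have h1 : ∀ z, j z = y := by
      intro z
      apply hemb.injective
      have h2 : i z ∈ Set.range i := Set.mem_range_self z
      rw [hi1] at h2
      rw [← Scheme.Hom.comp_apply, hj1]
      exact h2
    apply Set.eq_singleton_iff_unique_mem.2
    refine ⟨⟨(⟨⊥, Ideal.isPrime_bot⟩ : PrimeSpectrum F), h1 _⟩, ?_⟩
    rintro _ ⟨z, rfl⟩
    exact h1 z
  rw [← hy]
  exact geomIrreducible_of_point (k := (Spec R).residueField η) (fiberRes f η) j y hjr hj2 hK

end NeronSemistable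
end
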